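/- Let 0<α<n and 1<p<q<∞, and set β=n(1/p−1/q). Let Φ and Ψ be Young functions whose associate functions satisfy Φ̄∈B^β_p and Ψ̄∈B^β_{q'}, and suppose the pair of weights (u,σ) satisfies [u,σ]_{A^α_{p,q,Φ}}<∞ and [σ,u]_{A^α_{q',p',Ψ}}<∞. Then ‖I_α(·σ)‖_{L^p(σ)→L^{q}(u)} ≤ C·([u,σ]_{A^α_{p,q,Φ}}·‖M_{β,Φ̄}‖_{L^p→L^q} + [σ,u]_{A^α_{q',p',Ψ}}·‖M_{β,Ψ̄}‖_{L^{q'}→L^{p'}}), where C depends only on n, α, p and q. -/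

import Mathlib

open MeasureTheory ENNReal Set

noncomputable section

/-- `ℝ^n` with Lebesgue measure. -/
abbrev Rn (n : ℕ) : Type := Fin n → ℝ

/-- An axis-parallel (half-open) cube in `ℝ^n`. -/
structure Cube (n : ℕ) where
  corner : Fin n → ℝ
  side : ℝ
  side_pos : 0 < side

/-- The underlying set of a cube. -/
def Cube.set {n : ℕ} (Q : Cube n) : Set (Rn n) :=
  {x | ∀ i, Q.corner i ≤ x i ∧ x i < Q.corner i + Q.side}

/-- The volume `|Q|` of a cube. -/
def Cube.vol {n : ℕ} (Q : Cube n) : ℝ := Q.side ^ n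

/-- Conjugate exponent `p' = p/(p-1)`. -/
def conjExp (p : ℝ) : ℝ := p / (p - 1)

/-- Average over a cube of an `ℝ≥0∞`-valued function. -/
def avgE {n : ℕ} (Q : Cube n) (g : Rn n → ℝ≥0∞) : ℝ≥0∞ :=
  (∫⁻ x in Q.set, g x) / ENNReal.ofReal Q.vol

/-- Average over a cube of a (nonnegative) real weight. -/
def avgW {n : ℕ} (Q : Cube n) (w : Rn n → ℝ) : ℝ≥0∞ :=
  avgE Q fun x => ENNReal.ofReal (w x)

/-- Weighted `L^p` norm `‖f‖_{L^p(w)}` of an `ℝ≥0∞`-valued function. -/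
def LpW {n : ℕ} (f : Rn n → ℝ≥0∞) (p : ℝ) (w : Rn n → ℝ) : ℝ≥0∞ :=
  (∫⁻ x, f x ^ p * ENNReal.ofReal (w x)) ^ (1 / p)

/-- Weighted weak `L^q` quasinorm `‖f‖_{L^{q,∞}(w)}`. -/
def WeakLpW {n : ℕ} (f : Rn n → ℝ≥0∞) (q : ℝ) (w : Rn n → ℝ) : ℝ≥0∞ :=
  ⨆ (t : ℝ) (_ : 0 < t),
    ENNReal.ofReal t *
      (∫⁻ x in {x | ENNReal.ofReal t < f x}, ENNReal.ofReal (w x)) ^ (1 / q)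

/-- The fractional maximal operator `M_α`. -/
def fracMax {n : ℕ} (α : ℝ) (f : Rn n → ℝ≥0∞) (x : Rn n) : ℝ≥0∞ :=
  ⨆ (Q : Cube n) (_ : x ∈ Q.set),
    ENNReal.ofReal (Q.vol ^ (α / n - 1)) * ∫⁻ y in Q.set, f y

/-- The Euclidean norm on `ℝ^n`. -/
def eucNorm {n : ℕ} (x : Rn n) : ℝ := Real.sqrt (∑ i, x i ^ 2)

/-- The Riesz potential `I_α`. -/
def riesz {n : ℕ} (α : ℝ) (f : Rn n → ℝ≥0∞) (x : Rn n) : ℝ≥0∞ :=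
  ∫⁻ y, f y * ENNReal.ofReal (eucNorm (x - y) ^ (α - n))

/-- The product `fσ` of an `ℝ≥0∞`-valued function with a weight. -/
def mulW {n : ℕ} (f : Rn n → ℝ≥0∞) (w : Rn n → ℝ) : Rn n → ℝ≥0∞ :=
  fun x => f x * ENNReal.ofReal (w x)

/-- The operator norm `‖T(·σ)‖_{L^p(σ) → L^q(u)}` (least admissible constant). -/
def opNormStrong {n : ℕ} (T : (Rn n → ℝ≥0∞) → Rn n → ℝ≥0∞) (p q : ℝ)
    (σ u : Rn n → ℝ) : ℝ≥0∞ :=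
  ⨆ (f : Rn n → ℝ≥0∞) (_ : Measurable f), LpW (T (mulW f σ)) q u / LpW f p σ

/-- The weak-type operator norm `‖T(·σ)‖_{L^p(σ) → L^{q,∞}(u)}`. -/
def opNormWeak {n : ℕ} (T : (Rn n → ℝ≥0∞) → Rn n → ℝ≥0∞) (p q : ℝ)
    (σ u : Rn n → ℝ) : ℝ≥0∞ :=
  ⨆ (f : Rn n → ℝ≥0∞) (_ : Measurable f), WeakLpW (T (mulW f σ)) q u / LpW f p σ

/-- The operator norm `‖T‖_{L^p(v) → L^q(u)}` (no multiplication by the weight). -/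
def opNormPlain {n : ℕ} (T : (Rn n → ℝ≥0∞) → Rn n → ℝ≥0∞) (p q : ℝ)
    (v u : Rn n → ℝ) : ℝ≥0∞ :=
  ⨆ (f : Rn n → ℝ≥0∞) (_ : Measurable f), LpW (T f) q u / LpW f p v

/-- The weak-type operator norm `‖T‖_{L^p(v) → L^{q,∞}(u)}`. -/
def opNormPlainWeak {n : ℕ} (T : (Rn n → ℝ≥0∞) → Rn n → ℝ≥0∞) (p q : ℝ)
    (v u : Rn n → ℝ) : ℝ≥0∞ :=
  ⨆ (f : Rn n → ℝ≥0∞) (_ : Measurable f), WeakLpW (T f) q u / LpW f p v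

/-- A weight: a nonnegative locally integrable (measurable) function. -/
def IsWeight {n : ℕ} (w : Rn n → ℝ) : Prop :=
  Measurable w ∧ (∀ x, 0 ≤ w x) ∧ LocallyIntegrable w volume

/-- The local `A^α_{p,q}` functional `A^α_{p,q}(u,σ,Q)`. -/
def ApqQ {n : ℕ} (α p q : ℝ) (u σ : Rn n → ℝ) (Q : Cube n) : ℝ≥0∞ :=
  ENNReal.ofReal (Q.vol ^ (α / n + 1 / q - 1 / p)) * avgW Q u ^ (1 / q) *
    avgW Q σ ^ (1 / conjExp p)

/-- The joint constant `[u,σ]_{A^α_{p,q}}`. -/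
def Apq {n : ℕ} (α p q : ℝ) (u σ : Rn n → ℝ) : ℝ≥0∞ :=
  ⨆ Q : Cube n, ApqQ α p q u σ Q

/-- `A^α_{p,q}` for `ℝ≥0∞`-valued weights. -/
def ApqE {n : ℕ} (α p q : ℝ) (u σ : Rn n → ℝ≥0∞) : ℝ≥0∞ :=
  ⨆ Q : Cube n,
    ENNReal.ofReal (Q.vol ^ (α / n + 1 / q - 1 / p)) * avgE Q u ^ (1 / q) *
      avgE Q σ ^ (1 / conjExp p)

/-- Real-valued average over a cube. -/
def avgR {n : ℕ} (Q : Cube n) (w : Rn n → ℝ) : ℝ := (∫ x in Q.set, w x) / Q.vol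

/-- The local exponential `A_∞` functional `A^{exp}_∞(w,Q)`. -/
def AexpQ {n : ℕ} (Q : Cube n) (w : Rn n → ℝ) : ℝ :=
  avgR Q w * Real.exp (- avgR Q fun x => Real.log (w x))

/-- `w ∈ A_∞` (exponential definition). -/
def IsAinf {n : ℕ} (w : Rn n → ℝ) : Prop :=
  ∃ C : ℝ, ∀ Q : Cube n,
    IntegrableOn (fun x => Real.log (w x)) Q.set volume ∧ AexpQ Q w ≤ C

/-- The local Fujii–Wilson functional `A^M_∞(w,Q) = w(Q)⁻¹ ∫_Q M(wχ_Q)`. -/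
def FWQ {n : ℕ} (Q : Cube n) (w : Rn n → ℝ) : ℝ≥0∞ :=
  (∫⁻ x in Q.set, fracMax 0 (Q.set.indicator fun y => ENNReal.ofReal (w y)) x) /
    ∫⁻ x in Q.set, ENNReal.ofReal (w x)

/-- The Fujii–Wilson constant `[w]_{A^M_∞}`. -/
def FW {n : ℕ} (w : Rn n → ℝ) : ℝ≥0∞ := ⨆ Q : Cube n, FWQ Q w

/-- The local Muckenhoupt `A_r` functional. -/
def ArQ {n : ℕ} (r : ℝ) (v : Rn n → ℝ) (Q : Cube n) : ℝ≥0∞ :=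
  avgW Q v * (avgE Q fun x => ENNReal.ofReal (v x) ^ (1 - conjExp r)) ^ (r - 1)

/-- The Muckenhoupt constant `[v]_{A_r}`. -/
def ArC {n : ℕ} (r : ℝ) (v : Rn n → ℝ) : ℝ≥0∞ := ⨆ Q : Cube n, ArQ r v Q

/-- The mixed constant `[v]_{(A_r)^β (A^M_∞)^γ}`. -/
def mixedC {n : ℕ} (r β γ : ℝ) (v : Rn n → ℝ) : ℝ≥0∞ :=
  ⨆ Q : Cube n, ArQ r v Q ^ β * FWQ Q v ^ γ

/-- `Φ(t) = 1 + log t` applied to an `ℝ≥0∞` constant. -/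
def PhiLog (X : ℝ≥0∞) : ℝ≥0∞ :=
  if X = ∞ then ∞ else ENNReal.ofReal (1 + Real.log X.toReal)

/-- A Young function. -/
def IsYoung (Φ : ℝ → ℝ) : Prop :=
  ContinuousOn Φ (Ici 0) ∧ ConvexOn ℝ (Ici 0) Φ ∧ StrictMonoOn Φ (Ici 0) ∧
    Φ 0 = 0 ∧ Filter.Tendsto (fun t => Φ t / t) Filter.atTop Filter.atTop

/-- The associate (conjugate) Young function `Φ̄(t) = sup_{s>0} (st - Φ(s))`. -/
def assocFn (Φ : ℝ → ℝ) (t : ℝ) : ℝ :=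
  sSup {y : ℝ | ∃ s : ℝ, 0 < s ∧ y = s * t - Φ s}

/-- The localized Luxemburg average `‖f‖_{Φ,Q}`. -/
def luxNorm {n : ℕ} (Φ : ℝ → ℝ) (Q : Cube n) (f : Rn n → ℝ) : ℝ≥0∞ :=
  sInf ((fun l : ℝ => ENNReal.ofReal l) ''
    {l : ℝ | 0 < l ∧
      (∫⁻ x in Q.set, ENNReal.ofReal (Φ (|f x| / l))) ≤ ENNReal.ofReal Q.vol})

/-- The fractional Orlicz maximal operator `M_{β,Φ}`. -/
def orliczMax {n : ℕ} (β : ℝ) (Φ : ℝ → ℝ) (f : Rn n → ℝ) (x : Rn n) : ℝ≥0∞ :=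
  ⨆ (Q : Cube n) (_ : x ∈ Q.set), ENNReal.ofReal (Q.vol ^ (β / n)) * luxNorm Φ Q f

/-- Unweighted `L^p` norm of a real function. -/
def Lp0 {n : ℕ} (f : Rn n → ℝ) (p : ℝ) : ℝ≥0∞ :=
  (∫⁻ x, ENNReal.ofReal |f x| ^ p) ^ (1 / p)

/-- Unweighted `L^p` norm of an `ℝ≥0∞`-valued function. -/
def LpE {n : ℕ} (g : Rn n → ℝ≥0∞) (p : ℝ) : ℝ≥0∞ :=
  (∫⁻ x, g x ^ p) ^ (1 / p)

/-- The unweighted operator norm `‖M_{β,Φ}‖_{L^p → L^q}`. -/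
def orliczMaxNorm (n : ℕ) (β : ℝ) (Φ : ℝ → ℝ) (p q : ℝ) : ℝ≥0∞ :=
  ⨆ (f : Rn n → ℝ) (_ : Measurable f), LpE (orliczMax β Φ f) q / Lp0 f p

/-- The `B^β_p` integral `∫_c^∞ Φ(t)^{q/p} t^{-q} dt/t`, where `1/q = 1/p - β/n`. -/
def BInt (Φ : ℝ → ℝ) (p q : ℝ) (c : ℝ) : ℝ≥0∞ :=
  ∫⁻ t in Ioi c, ENNReal.ofReal (Φ t ^ (q / p) * t ^ (-q) / t)

/-- The `B^β_p` condition (with `q` given by `1/q = 1/p - β/n`). -/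
def BCond (Φ : ℝ → ℝ) (p q : ℝ) : Prop := ∃ c : ℝ, 0 < c ∧ BInt Φ p q c < ∞

/-- The bump constant `[u,σ]_{A^α_{p,q,Φ}}`. -/
def bumpA {n : ℕ} (α p q : ℝ) (Φ : ℝ → ℝ) (u σ : Rn n → ℝ) : ℝ≥0∞ :=
  ⨆ Q : Cube n,
    ENNReal.ofReal (Q.vol ^ (α / n + 1 / q - 1 / p)) * avgW Q u ^ (1 / q) *
      luxNorm Φ Q (fun x => σ x ^ (1 / conjExp p))

/-- A dyadic grid in `ℝ^n`. -/
def IsDyadicGrid {n : ℕ} (D : Set (Cube n)) : Prop :=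
  (∀ Q ∈ D, ∃ k : ℤ, Q.side = (2 : ℝ) ^ k) ∧
  (∀ Q ∈ D, ∀ P ∈ D, Q.set ∩ P.set = P.set ∨ Q.set ∩ P.set = Q.set ∨
    Q.set ∩ P.set = ∅) ∧
  (∀ k : ℤ, ∀ x : Rn n, ∃! Q : Cube n, Q ∈ D ∧ Q.side = (2 : ℝ) ^ k ∧ x ∈ Q.set)

/-- The outer dyadic Riesz potential `I_α^{Q₀}`. -/
def outerRiesz {n : ℕ} (D : Set (Cube n)) (α : ℝ) (Q₀ : Cube n)
    (f : Rn n → ℝ≥0∞) (x : Rn n) : ℝ≥0∞ :=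
  ∑' Q : {Q : Cube n // Q ∈ D ∧ Q₀.set ⊆ Q.set},
    Q.1.set.indicator
      (fun _ => ENNReal.ofReal (Q.1.vol ^ (α / n - 1)) * ∫⁻ y in Q.1.set, f y) x

/-- The outer testing constant `[u,σ]_{I_α^{out},p,q}`. -/
def outerTest {n : ℕ} (D : Set (Cube n)) (α p q : ℝ) (u σ : Rn n → ℝ) : ℝ≥0∞ :=
  ⨆ (Q₀ : Cube n) (_ : Q₀ ∈ D),
    (∫⁻ x, outerRiesz D α Q₀ (Q₀.set.indicator fun y => ENNReal.ofReal (σ y)) x ^ q *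
        ENNReal.ofReal (u x)) ^ (1 / q) /
      (∫⁻ x in Q₀.set, ENNReal.ofReal (σ x)) ^ (1 / p)

/-- The dyadic fractional maximal operator `M_α^𝒟`. -/
def dyadicFracMax {n : ℕ} (D : Set (Cube n)) (α : ℝ) (f : Rn n → ℝ≥0∞)
    (x : Rn n) : ℝ≥0∞ :=
  ⨆ (Q : Cube n) (_ : Q ∈ D) (_ : x ∈ Q.set),
    ENNReal.ofReal (Q.vol ^ (α / n - 1)) * ∫⁻ y in Q.set, f y

/-- A sparse family `S ⊆ D` with associated disjoint thick subsets `E Q ⊆ Q`. -/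
def IsSparse {n : ℕ} (D S : Set (Cube n)) (E : Cube n → Set (Rn n)) : Prop :=
  S ⊆ D ∧
  (∀ Q ∈ S, E Q ⊆ Q.set ∧ MeasurableSet (E Q) ∧
    ENNReal.ofReal Q.vol ≤ 2 * volume (E Q)) ∧
  S.PairwiseDisjoint E

/-- The sparse operator `L_α^S`. -/
def sparseOp {n : ℕ} (S : Set (Cube n)) (E : Cube n → Set (Rn n)) (α : ℝ)
    (f : Rn n → ℝ≥0∞) (x : Rn n) : ℝ≥0∞ :=
  ∑' Q : S,
    (E Q.1).indicator
      (fun _ => ENNReal.ofReal (Q.1.vol ^ (α / n - 1)) * ∫⁻ y in Q.1.set, f y) x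

/-- The one-dimensional fractional maximal operator over bounded intervals. -/
def fm1 (γ : ℝ) (f : ℝ → ℝ≥0∞) (x : ℝ) : ℝ≥0∞ :=
  ⨆ (a : ℝ) (b : ℝ) (_ : a < b) (_ : x ∈ Icc a b),
    ENNReal.ofReal ((b - a) ^ (γ - 1)) * ∫⁻ y in Ioo a b, f y

/-- The sum of the geometric series with ratio `2 ^ (-s)`. -/
def geomConst (s : ℝ) : ℝ≥0∞ := (1 - (2 : ℝ≥0∞) ^ (-s))⁻¹

lemma geomConst_lt_top {s : ℝ} (hs : 0 < s) : geomConst s < ∞ := by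
  unfold geomConst
  rw [ENNReal.inv_lt_top, tsub_pos_iff_lt]
  exact ENNReal.rpow_lt_one_of_one_lt_of_neg ENNReal.one_lt_two (by linarith)

lemma two_zpow_pos (k : ℤ) : 0 < (2 : ℝ≥0∞) ^ k :=
  ENNReal.zpow_pos two_ne_zero ofNat_ne_top k

lemma two_zpow_ne_top (k : ℤ) : (2 : ℝ≥0∞) ^ k ≠ ∞ :=
  ENNReal.zpow_ne_top two_ne_zero ofNat_ne_top k

lemma two_zpow_add_one (k : ℤ) : (2 : ℝ≥0∞) ^ (k + 1) = 2 * 2 ^ k := by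
  rw [ENNReal.zpow_add two_ne_zero ofNat_ne_top, zpow_one, mul_comm]

lemma two_zpow_le {a b : ℤ} (h : a ≤ b) : (2 : ℝ≥0∞) ^ a ≤ 2 ^ b :=
  ENNReal.zpow_le_of_le one_le_two h

lemma lt_of_two_zpow_lt {a b : ℤ} (h : (2 : ℝ≥0∞) ^ a < 2 ^ b) : a < b := by
  by_contra hab
  exact absurd h (not_lt.2 (two_zpow_le (not_lt.1 hab)))

/-- Geometric sums of powers of two are dominated by an upper bound for their largest term. -/
lemma sum_zpow_rpow_le (I : Finset ℤ) {t : ℝ≥0∞} (h : ∀ i ∈ I, (2 : ℝ≥0∞) ^ i ≤ t) {s : ℝ}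
    (hs : 0 < s) : ∑ i ∈ I, ((2 : ℝ≥0∞) ^ i) ^ s ≤ geomConst s * t ^ s := by
  rcases I.eq_empty_or_nonempty with rfl | hI
  · simp
  set m := I.max' hI
  have hm : m ∈ I := I.max'_mem hI
  have key : ∀ i ∈ I, ((2 : ℝ≥0∞) ^ i) ^ s
      = ((2 : ℝ≥0∞) ^ m) ^ s * ((2 : ℝ≥0∞) ^ (-s)) ^ ((m - i).toNat) := by
    intro i hi
    have him : i ≤ m := I.le_max' i hi
    have e : ((m - i).toNat : ℝ) = (m : ℝ) - i := by
      have : (((m - i).toNat : ℤ) : ℝ) = ((m - i : ℤ) : ℝ) := by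
        rw [Int.toNat_of_nonneg (by omega)]
      push_cast at this
      simpa using this
    rw [← ENNReal.rpow_intCast, ← ENNReal.rpow_intCast, ← ENNReal.rpow_natCast,
      ← ENNReal.rpow_mul, ← ENNReal.rpow_mul, ← ENNReal.rpow_mul,
      ← ENNReal.rpow_add _ _ two_ne_zero ofNat_ne_top, e]
    congr 1
    ring
  rw [Finset.sum_congr rfl key, ← Finset.mul_sum, mul_comm]
  gcongr
  · have : ∑ i ∈ I, ((2 : ℝ≥0∞) ^ (-s)) ^ ((m - i).toNat)
        = ∑ j ∈ I.image (fun i => (m - i).toNat), ((2 : ℝ≥0∞) ^ (-s)) ^ j := by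
      rw [Finset.sum_image]
      intro a ha b hb hab
      have h1 : a ≤ m := I.le_max' a ha
      have h2 : b ≤ m := I.le_max' b hb
      simp only at hab
      omega
    rw [this, geomConst, ← ENNReal.tsum_geometric]
    exact ENNReal.sum_le_tsum _
  · exact h m hm

section Nested

open scoped Classical

variable {X : Type*}

/-- A family of sets any two of which are nested or disjoint. -/
def IsNested (S : Finset (Set X)) : Prop :=
  ∀ P ∈ S, ∀ Q ∈ S, P ⊆ Q ∨ Q ⊆ P ∨ Disjoint P Q

/-- `top Q` is the largest member of `S` which contains `Q` and has the same level as `Q`. -/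
def IsTopMap (S : Finset (Set X)) (lvl : Set X → ℤ) (top : Set X → Set X) : Prop :=
  ∀ Q ∈ S, top Q ∈ S ∧ Q ⊆ top Q ∧ lvl (top Q) = lvl Q ∧
    ∀ P ∈ S, Q ⊆ P → lvl P = lvl Q → P ⊆ top Q

lemma IsNested.mono {S T : Finset (Set X)} (hS : IsNested S) (h : T ⊆ S) : IsNested T :=
  fun P hP Q hQ => hS P (h hP) Q (h hQ)

lemma IsNested.comparable {S : Finset (Set X)} (hS : IsNested S) {P Q : Set X} (hP : P ∈ S)
    (hQ : Q ∈ S) {x : X} (hxP : x ∈ P) (hxQ : x ∈ Q) : P ⊆ Q ∨ Q ⊆ P := by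
  rcases hS P hP Q hQ with h | h | h
  · exact Or.inl h
  · exact Or.inr h
  · exact absurd hxQ (Set.disjoint_left.1 h hxP)

lemma IsNested.exists_topMap {S : Finset (Set X)} (hS : IsNested S)
    (hne : ∀ Q ∈ S, Q.Nonempty) (lvl : Set X → ℤ) : ∃ top, IsTopMap S lvl top := by
  have : ∀ Q, ∃ R, Q ∈ S → R ∈ S ∧ Q ⊆ R ∧ lvl R = lvl Q ∧
      ∀ P ∈ S, Q ⊆ P → lvl P = lvl Q → P ⊆ R := by
    intro Q
    by_cases hQ : Q ∈ S
    · obtain ⟨R, hR⟩ := (S.filter fun P => Q ⊆ P ∧ lvl P = lvl Q).exists_maximal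
        ⟨Q, by simp [hQ]⟩
      have hR1 := hR.1
      simp only [Finset.mem_filter] at hR1
      refine ⟨R, fun _ => ⟨hR1.1, hR1.2.1, hR1.2.2, fun P hP hQP hlP => ?_⟩⟩
      obtain ⟨x, hx⟩ := hne Q hQ
      rcases hS.comparable hP hR1.1 (hQP hx) (hR1.2.1 hx) with h | h
      · exact h
      · exact hR.2 (by simp [hP, hQP, hlP]) h
    · exact ⟨Q, fun h => absurd h hQ⟩
  choose top htop using this
  exact ⟨top, fun Q hQ => htop Q hQ⟩

lemma IsTopMap.eq_of_mem {S : Finset (Set X)} (hS : IsNested S) {lvl : Set X → ℤ}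
    {top : Set X → Set X} (htop : IsTopMap S lvl top) {R₁ R₂ : Set X} (h₁ : R₁ ∈ S.image top)
    (h₂ : R₂ ∈ S.image top) {x : X} (hx₁ : x ∈ R₁) (hx₂ : x ∈ R₂) (hl : lvl R₁ = lvl R₂) :
    R₁ = R₂ := by
  obtain ⟨Q₁, hQ₁, rfl⟩ := Finset.mem_image.1 h₁
  obtain ⟨Q₂, hQ₂, rfl⟩ := Finset.mem_image.1 h₂
  obtain ⟨a₁, b₁, c₁, d₁⟩ := htop Q₁ hQ₁
  obtain ⟨a₂, b₂, c₂, d₂⟩ := htop Q₂ hQ₂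
  rcases hS.comparable a₁ a₂ hx₁ hx₂ with h | h
  · exact h.antisymm (d₁ _ a₂ (b₁.trans h) (hl.symm.trans c₁))
  · exact (d₂ _ a₁ (b₂.trans h) (hl.trans c₂)).antisymm h

/-- At most one top set of each level passes through a point, so sums are geometric. -/
lemma IsTopMap.sum_pow_le {S : Finset (Set X)} (hS : IsNested S) {lvl : Set X → ℤ}
    {top : Set X → Set X} (htop : IsTopMap S lvl top) {T : Finset (Set X)}
    (hT : T ⊆ S.image top) {x : X} (hx : ∀ R ∈ T, x ∈ R) {t : ℝ≥0∞}
    (ht : ∀ R ∈ T, (2 : ℝ≥0∞) ^ lvl R ≤ t) {s : ℝ} (hs : 0 < s) :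
    ∑ R ∈ T, ((2 : ℝ≥0∞) ^ lvl R) ^ s ≤ geomConst s * t ^ s := by
  have : ∑ R ∈ T, ((2 : ℝ≥0∞) ^ lvl R) ^ s = ∑ i ∈ T.image lvl, ((2 : ℝ≥0∞) ^ i) ^ s := by
    rw [Finset.sum_image]
    intro a ha b hb hab
    exact htop.eq_of_mem hS (hT ha) (hT hb) (hx a ha) (hx b hb) hab
  rw [this]
  refine sum_zpow_rpow_le _ ?_ hs
  intro i hi
  obtain ⟨R, hR, rfl⟩ := Finset.mem_image.1 hi
  exact ht R hR

lemma IsTopMap.sum_pow_mul_measure_le [MeasurableSpace X] {S : Finset (Set X)} (hS : IsNested S)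
    (hm : ∀ Q ∈ S, MeasurableSet Q) {lvl : Set X → ℤ} {top : Set X → Set X}
    (htop : IsTopMap S lvl top) {F : Set X} (hF : ∀ Q ∈ S, Q ⊆ F) (hFm : MeasurableSet F)
    {t : ℝ≥0∞} (ht : ∀ R ∈ S, (2 : ℝ≥0∞) ^ lvl R ≤ t) {s : ℝ} (hs : 0 < s) (ν : Measure X) :
    ∑ R ∈ S.image top, ((2 : ℝ≥0∞) ^ lvl R) ^ s * ν R ≤ geomConst s * t ^ s * ν F := by
  have hsub : ∀ R ∈ S.image top, R ∈ S := by
    intro R hR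
    obtain ⟨Q, hQ, rfl⟩ := Finset.mem_image.1 hR
    exact (htop Q hQ).1
  calc ∑ R ∈ S.image top, ((2 : ℝ≥0∞) ^ lvl R) ^ s * ν R
      = ∑ R ∈ S.image top, ∫⁻ x, R.indicator (fun _ => ((2 : ℝ≥0∞) ^ lvl R) ^ s) x ∂ν := by
        refine Finset.sum_congr rfl fun R hR => ?_
        rw [lintegral_indicator_const (hm R (hsub R hR))]
    _ = ∫⁻ x, ∑ R ∈ S.image top, R.indicator (fun _ => ((2 : ℝ≥0∞) ^ lvl R) ^ s) x ∂ν := by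
        rw [lintegral_finsetSum]
        exact fun R hR => measurable_const.indicator (hm R (hsub R hR))
    _ ≤ ∫⁻ x, F.indicator (fun _ => geomConst s * t ^ s) x ∂ν := by
        refine lintegral_mono fun x => ?_
        by_cases hx : x ∈ F
        · rw [Set.indicator_of_mem hx]
          simp only [Set.indicator_apply]
          rw [← Finset.sum_filter]
          refine htop.sum_pow_le (x := x) hS (Finset.filter_subset _ _) ?_ ?_ hs
          · intro R hR
            exact (Finset.mem_filter.1 hR).2
          · intro R hR
            exact ht R (hsub R (Finset.mem_filter.1 hR).1)
        · rw [Finset.sum_eq_zero]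
          · exact zero_le
          · intro R hR
            exact Set.indicator_of_notMem (fun h => hx (hF R (hsub R hR) h)) _
    _ = _ := by rw [lintegral_indicator_const hFm]

end Nested

section Testing

open scoped Classical

variable {X : Type*}

lemma IsTopMap.image_subset {S : Finset (Set X)} {lvl : Set X → ℤ} {top : Set X → Set X}
    (htop : IsTopMap S lvl top) {R : Set X} (hR : R ∈ S.image top) : R ∈ S := by
  obtain ⟨Q, hQ, rfl⟩ := Finset.mem_image.1 hR
  exact (htop Q hQ).1

/-- The sum of `lam P` over the members `P ∋ x` of the family which contain `Q`. -/
def chainSum (S : Finset (Set X)) (lam : Set X → ℝ≥0∞) (Q : Set X) (x : X) : ℝ≥0∞ :=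
  ∑ P ∈ S with Q ⊆ P, P.indicator (fun _ => lam P) x

lemma chainSum_mono {S T : Finset (Set X)} (h : S ⊆ T) (lam : Set X → ℝ≥0∞) (Q : Set X) (x : X) :
    chainSum S lam Q x ≤ chainSum T lam Q x :=
  Finset.sum_le_sum_of_subset (Finset.filter_subset_filter _ h)

lemma exists_dyadic_level (S : Finset (Set X)) (a : Set X → ℝ≥0∞) (h0 : ∀ Q ∈ S, a Q ≠ 0)
    (h1 : ∀ Q ∈ S, a Q ≠ ∞) :
    ∃ lvl : Set X → ℤ, ∀ Q ∈ S, (2 : ℝ≥0∞) ^ lvl Q < a Q ∧ a Q ≤ (2 : ℝ≥0∞) ^ (lvl Q + 1) := by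
  have : ∀ Q, ∃ k : ℤ, Q ∈ S → (2 : ℝ≥0∞) ^ k < a Q ∧ a Q ≤ (2 : ℝ≥0∞) ^ (k + 1) := by
    intro Q
    by_cases hQ : Q ∈ S
    · obtain ⟨k, hk⟩ := ENNReal.exists_mem_Ioc_zpow (h0 Q hQ) (h1 Q hQ) one_lt_two ofNat_ne_top
      exact ⟨k, fun _ => hk⟩
    · exact ⟨0, fun h => absurd h hQ⟩
  choose lvl h using this
  exact ⟨lvl, h⟩

variable [MeasurableSpace X]

lemma measurable_chainSum {S : Finset (Set X)} (hm : ∀ Q ∈ S, MeasurableSet Q)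
    (lam : Set X → ℝ≥0∞) (Q : Set X) : Measurable (chainSum S lam Q) :=
  Finset.measurable_fun_sum _ fun P hP =>
    measurable_const.indicator (hm P (Finset.mem_filter.1 hP).1)

/-- The outer testing condition for the positive operator with coefficients `lam`. -/
def OuterTesting (S : Finset (Set X)) (lam : Set X → ℝ≥0∞) (σ u : Measure X) (p q : ℝ)
    (K : ℝ≥0∞) : Prop :=
  ∀ Q ∈ S, σ Q * (∫⁻ x, chainSum S lam Q x ^ q ∂u) ^ (1 / q) ≤ K * σ Q ^ (1 / p)

lemma OuterTesting.mono {S T : Finset (Set X)} {lam : Set X → ℝ≥0∞} {σ u : Measure X} {p q : ℝ}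
    {K : ℝ≥0∞} (hq : 0 < q) (h : OuterTesting T lam σ u p q K) (hST : S ⊆ T) :
    OuterTesting S lam σ u p q K := by
  intro Q hQ
  refine le_trans ?_ (h Q (hST hQ))
  gcongr with x
  exact chainSum_mono hST lam Q x

/-- Sets of comparable `σ`-measure inside a common set of comparable measure form a chain. -/
lemma fiber_sum_le {p q q' : ℝ} (hp : 1 < p) (hqq : q'.HolderConjugate q)
    {S : Finset (Set X)} (hS : IsNested S) (hm : ∀ Q ∈ S, MeasurableSet Q) {lam : Set X → ℝ≥0∞}
    {σ u : Measure X} {K : ℝ≥0∞} (hK : OuterTesting S lam σ u p q K) {k : ℤ} {R : Set X}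
    (hRk : σ R ≤ (2 : ℝ≥0∞) ^ (k + 1)) {T : Finset (Set X)} (hTS : T ⊆ S)
    (hT : ∀ Q ∈ T, Q ⊆ R ∧ (2 : ℝ≥0∞) ^ k < σ Q) {h : X → ℝ≥0∞} (hh : Measurable h) :
    ∑ Q ∈ T, lam Q * σ Q * ∫⁻ x in Q, h x ∂u
      ≤ 4 * K * ((2 : ℝ≥0∞) ^ k) ^ (1 / p) * (∫⁻ x in R, h x ^ q' ∂u) ^ (1 / q') := by
  rcases T.eq_empty_or_nonempty with rfl | hTne
  · simp
  obtain ⟨Q₀, hQ₀⟩ := T.exists_minimal hTne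
  have hQ₀T := hQ₀.1
  have hchain : ∀ Q ∈ T, Q₀ ⊆ Q := by
    intro Q hQ
    rcases hS Q₀ (hTS hQ₀T) Q (hTS hQ) with h1 | h1 | h1
    · exact h1
    · exact hQ₀.2 hQ h1
    · exfalso
      have h2 : σ Q₀ + σ Q ≤ σ R := by
        rw [← measure_union h1 (hm Q (hTS hQ))]
        exact measure_mono (union_subset (hT _ hQ₀T).1 (hT _ hQ).1)
      have h3 : (2 : ℝ≥0∞) ^ k + 2 ^ k < σ Q₀ + σ Q :=
        ENNReal.add_lt_add (hT _ hQ₀T).2 (hT _ hQ).2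
      rw [two_zpow_add_one, two_mul] at hRk
      exact absurd (h3.trans_le (h2.trans hRk)) (lt_irrefl _)
  set N := (∫⁻ x, chainSum S lam Q₀ x ^ q ∂u) ^ (1 / q) with hN
  have hN1 : (2 : ℝ≥0∞) ^ (k + 1) * N ≤ 4 * K * ((2 : ℝ≥0∞) ^ k) ^ (1 / p) := by
    calc (2 : ℝ≥0∞) ^ (k + 1) * N = 2 * ((2 : ℝ≥0∞) ^ k * N) := by
          rw [two_zpow_add_one, mul_assoc]
      _ ≤ 2 * (σ Q₀ * N) := by gcongr; exact (hT _ hQ₀T).2.le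
      _ ≤ 2 * (K * σ Q₀ ^ (1 / p)) := mul_le_mul_right (hK Q₀ (hTS hQ₀T)) _
      _ ≤ 2 * (K * ((2 : ℝ≥0∞) ^ (k + 1)) ^ (1 / p)) := by
          gcongr
          exact (measure_mono (hT _ hQ₀T).1).trans hRk
      _ ≤ 2 * (K * (2 * ((2 : ℝ≥0∞) ^ k) ^ (1 / p))) := by
          gcongr
          rw [two_zpow_add_one, ENNReal.mul_rpow_of_nonneg _ _ (by positivity)]
          gcongr
          calc (2 : ℝ≥0∞) ^ (1 / p) ≤ 2 ^ (1 : ℝ) :=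
                ENNReal.rpow_le_rpow_of_exponent_le one_le_two
                  ((div_le_one (by linarith)).2 hp.le)
            _ = 2 := ENNReal.rpow_one 2
      _ = 4 * K * ((2 : ℝ≥0∞) ^ k) ^ (1 / p) := by ring
  calc ∑ Q ∈ T, lam Q * σ Q * ∫⁻ x in Q, h x ∂u
      ≤ ∑ Q ∈ T, 2 ^ (k + 1) * ∫⁻ x in R, Q.indicator (fun _ => lam Q) x * h x ∂u := by
        refine Finset.sum_le_sum fun Q hQ => ?_
        have e : ∫⁻ x in R, Q.indicator (fun _ => lam Q) x * h x ∂u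
            = lam Q * ∫⁻ x in Q, h x ∂u := by
          rw [← lintegral_const_mul _ hh]
          have : ∀ x, Q.indicator (fun _ => lam Q) x * h x
              = Q.indicator (fun x => lam Q * h x) x := by
            intro x
            by_cases hx : x ∈ Q <;> simp [hx]
          simp_rw [this]
          rw [lintegral_indicator (hm Q (hTS hQ)), Measure.restrict_restrict (hm Q (hTS hQ)),
            inter_eq_self_of_subset_left (hT Q hQ).1]
        rw [e, mul_comm (lam Q), mul_assoc]
        gcongr
        exact (measure_mono (hT Q hQ).1).trans hRk
    _ = 2 ^ (k + 1) * ∫⁻ x in R, (∑ Q ∈ T, Q.indicator (fun _ => lam Q) x) * h x ∂u := by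
        rw [← Finset.mul_sum, ← lintegral_finsetSum]
        · simp_rw [Finset.sum_mul]
        · intro Q hQ
          exact (measurable_const.indicator (hm Q (hTS hQ))).mul hh
    _ ≤ 2 ^ (k + 1) * ∫⁻ x in R, h x * chainSum S lam Q₀ x ∂u := by
        refine mul_le_mul_right (lintegral_mono fun x => ?_) _
        rw [mul_comm]
        refine mul_le_mul_right ?_ _
        exact Finset.sum_le_sum_of_subset fun Q hQ =>
          Finset.mem_filter.2 ⟨hTS hQ, hchain Q hQ⟩
    _ ≤ 2 ^ (k + 1) * ((∫⁻ x in R, h x ^ q' ∂u) ^ (1 / q') *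
          (∫⁻ x in R, chainSum S lam Q₀ x ^ q ∂u) ^ (1 / q)) := by
        gcongr
        exact ENNReal.lintegral_mul_le_Lp_mul_Lq _ hqq hh.aemeasurable
          (measurable_chainSum hm lam Q₀).aemeasurable
    _ ≤ 2 ^ (k + 1) * ((∫⁻ x in R, h x ^ q' ∂u) ^ (1 / q') * N) := by
        rw [hN]
        have := hqq.symm.pos
        gcongr
        exact Measure.restrict_le_self
    _ = 2 ^ (k + 1) * N * (∫⁻ x in R, h x ^ q' ∂u) ^ (1 / q') := by ring
    _ ≤ _ := by gcongr

/-- Outer testing controls the operator localized to a set `F`. -/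
lemma localized_sum_le {p q q' : ℝ} (hp : 1 < p) (hpq : p < q) (hqq : q'.HolderConjugate q)
    {S : Finset (Set X)} (hS : IsNested S) (hm : ∀ Q ∈ S, MeasurableSet Q)
    {lam : Set X → ℝ≥0∞} {σ u : Measure X} {K : ℝ≥0∞} (hK : OuterTesting S lam σ u p q K)
    (hσ : ∀ Q ∈ S, σ Q ≠ 0) {F : Set X} (hF : ∀ Q ∈ S, Q ⊆ F) (hFm : MeasurableSet F)
    (hFt : σ F ≠ ∞) {h : X → ℝ≥0∞} (hh : Measurable h) :
    ∑ Q ∈ S, lam Q * σ Q * ∫⁻ x in Q, h x ∂u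
      ≤ 4 * geomConst (1 / p - 1 / q) * K * σ F ^ (1 / p) * (∫⁻ x, h x ^ q' ∂u) ^ (1 / q') := by
  have hp0 : 0 < p := by linarith
  have hq0 : 0 < q := by linarith
  have hq'0 : 0 < q' := hqq.pos
  set ε := 1 / p - 1 / q with hε
  have hε0 : 0 < ε := by
    rw [hε, sub_pos]
    exact one_div_lt_one_div_of_lt hp0 hpq
  have hone : 1 / q' + 1 / q = 1 := by simpa using hqq.inv_add_inv_eq_one
  obtain ⟨lvl, hlvl⟩ := exists_dyadic_level S σ hσ
    fun Q hQ => ne_top_of_le_ne_top hFt (measure_mono (hF Q hQ))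
  have hne : ∀ Q ∈ S, Q.Nonempty := fun Q hQ => nonempty_of_measure_ne_zero (hσ Q hQ)
  obtain ⟨top, htop⟩ := hS.exists_topMap hne lvl
  set ν : Measure X := u.withDensity fun x => h x ^ q' with hν
  have hνR : ∀ R, MeasurableSet R → ∫⁻ x in R, h x ^ q' ∂u = ν R := fun R hR => by
    rw [hν, withDensity_apply _ hR]
  have hlt : ∀ R ∈ S, (2 : ℝ≥0∞) ^ lvl R ≤ σ F := fun R hR =>
    (hlvl R hR).1.le.trans (measure_mono (hF R hR))
  calc ∑ Q ∈ S, lam Q * σ Q * ∫⁻ x in Q, h x ∂u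
      = ∑ R ∈ S.image top, ∑ Q ∈ S with top Q = R, lam Q * σ Q * ∫⁻ x in Q, h x ∂u :=
        (Finset.sum_fiberwise_of_maps_to (fun Q hQ => Finset.mem_image_of_mem _ hQ) _).symm
    _ ≤ ∑ R ∈ S.image top, 4 * K * ((2 : ℝ≥0∞) ^ lvl R) ^ (1 / p) * (ν R) ^ (1 / q') := by
        refine Finset.sum_le_sum fun R hR => ?_
        have hRS := htop.image_subset hR
        rw [← hνR R (hm R hRS)]
        refine fiber_sum_le hp hqq hS hm hK (hlvl R hRS).2 (Finset.filter_subset _ _)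
          ?_ hh
        intro Q hQ
        obtain ⟨hQS, rfl⟩ := Finset.mem_filter.1 hQ
        obtain ⟨-, h2, h3, -⟩ := htop Q hQS
        exact ⟨h2, h3 ▸ (hlvl Q hQS).1⟩
    _ = 4 * K * ∑ R ∈ S.image top, (((2 : ℝ≥0∞) ^ lvl R) ^ ε * ν R) ^ (1 / q') *
          (((2 : ℝ≥0∞) ^ lvl R) ^ (1 + ε)) ^ (1 / q) := by
        rw [Finset.mul_sum]
        refine Finset.sum_congr rfl fun R hR => ?_
        have e : ((2 : ℝ≥0∞) ^ lvl R) ^ (1 / p)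
            = (((2 : ℝ≥0∞) ^ lvl R) ^ ε) ^ (1 / q') * (((2 : ℝ≥0∞) ^ lvl R) ^ (1 + ε)) ^ (1 / q) := by
          rw [← ENNReal.rpow_mul, ← ENNReal.rpow_mul,
            ← ENNReal.rpow_add _ _ (two_zpow_pos _).ne' (two_zpow_ne_top _)]
          congr 1
          have : 1 / p = ε * (1 / q' + 1 / q) + 1 / q := by rw [hone, hε]; ring
          rw [this]; ring
        rw [e, ENNReal.mul_rpow_of_nonneg _ _ (by positivity)]
        ring
    _ ≤ 4 * K * ((∑ R ∈ S.image top, ((2 : ℝ≥0∞) ^ lvl R) ^ ε * ν R) ^ (1 / q') *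
          (∑ R ∈ S.image top, ((2 : ℝ≥0∞) ^ lvl R) ^ ε * σ R) ^ (1 / q)) := by
        gcongr
        refine (ENNReal.inner_le_Lp_mul_Lq _ _ _ hqq).trans ?_
        have e1 : ∀ (a : ℝ≥0∞) {r : ℝ}, 0 < r → (a ^ (1 / r)) ^ r = a := fun a r hr => by
          rw [← ENNReal.rpow_mul, one_div_mul_cancel hr.ne', ENNReal.rpow_one]
        simp_rw [e1 _ hq'0, e1 _ hq0]
        gcongr with R hR
        rw [add_comm, ENNReal.rpow_add _ _ (two_zpow_pos _).ne' (two_zpow_ne_top _),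
          ENNReal.rpow_one]
        gcongr
        exact (hlvl R (htop.image_subset hR)).1.le
    _ ≤ 4 * K * ((geomConst ε * σ F ^ ε * ν F) ^ (1 / q') *
          (geomConst ε * σ F ^ ε * σ F) ^ (1 / q)) := by
        gcongr
        · exact htop.sum_pow_mul_measure_le hS hm hF hFm hlt hε0 ν
        · exact htop.sum_pow_mul_measure_le hS hm hF hFm hlt hε0 σ
    _ = 4 * K * (((geomConst ε * σ F ^ ε) ^ (1 / q') * (geomConst ε * σ F ^ ε) ^ (1 / q)) *
          (σ F ^ (1 / q)) * ν F ^ (1 / q')) := by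
        rw [ENNReal.mul_rpow_of_nonneg _ (ν F) (by positivity),
          ENNReal.mul_rpow_of_nonneg _ (σ F) (by positivity)]
        ring
    _ = 4 * K * (geomConst ε * (σ F ^ ε * σ F ^ (1 / q)) * ν F ^ (1 / q')) := by
        rw [← ENNReal.rpow_add_of_nonneg _ _ (by positivity) (by positivity), hone,
          ENNReal.rpow_one]
        ring
    _ = 4 * geomConst ε * K * σ F ^ (1 / p) * ν F ^ (1 / q') := by
        rw [← ENNReal.rpow_add_of_nonneg _ _ hε0.le (by positivity)]
        have : ε + 1 / q = 1 / p := by rw [hε]; ring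
        rw [this]
        ring
    _ ≤ _ := by
        gcongr
        rw [← hνR F hFm]
        exact setLIntegral_le_lintegral _ _

end Testing

section Corona

open scoped Classical

variable {X : Type*}

/-- A principal decomposition of a nested family relative to the values `a`: the level of `Q` is
the dyadic size of the largest value of `a` over the members of `S` containing `Q`. -/
structure IsPrincipal (S : Finset (Set X)) (a : Set X → ℝ≥0∞) (lvl : Set X → ℤ)
    (top : Set X → Set X) : Prop where
  isTopMap : IsTopMap S lvl top
  anti : ∀ P ∈ S, ∀ Q ∈ S, Q ⊆ P → lvl P ≤ lvl Q
  le : ∀ Q ∈ S, a Q ≤ (2 : ℝ≥0∞) ^ (lvl Q + 1)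
  lt : ∀ R ∈ S.image top, (2 : ℝ≥0∞) ^ lvl R < a R

lemma IsNested.exists_principal {S : Finset (Set X)} (hS : IsNested S)
    (hne : ∀ Q ∈ S, Q.Nonempty) {a : Set X → ℝ≥0∞} (h0 : ∀ Q ∈ S, a Q ≠ 0)
    (h1 : ∀ Q ∈ S, a Q ≠ ∞) : ∃ lvl top, IsPrincipal S a lvl top := by
  set b : Set X → ℝ≥0∞ := fun Q => (S.filter fun P => Q ⊆ P).sup a with hb
  have hab : ∀ Q ∈ S, a Q ≤ b Q := fun Q hQ =>
    Finset.le_sup (f := a) (Finset.mem_filter.2 ⟨hQ, subset_rfl⟩)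
  have hbanti : ∀ P Q, Q ⊆ P → b P ≤ b Q := fun P Q hQP =>
    Finset.sup_mono fun R hR => by
      simp only [Finset.mem_filter] at hR ⊢
      exact ⟨hR.1, hQP.trans hR.2⟩
  obtain ⟨lvl, hlvl⟩ := exists_dyadic_level S b
    (fun Q hQ h => h0 Q hQ (le_zero_iff.1 (h ▸ hab Q hQ)))
    (fun Q hQ => by
      refine ((Finset.sup_lt_iff (by simp)).2 fun P hP => ?_).ne
      exact (h1 P (Finset.mem_filter.1 hP).1).lt_top)
  obtain ⟨top, htop⟩ := hS.exists_topMap hne lvl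
  have hanti : ∀ P ∈ S, ∀ Q ∈ S, Q ⊆ P → lvl P ≤ lvl Q := fun P hP Q hQ hQP =>
    Int.lt_add_one_iff.1
      (lt_of_two_zpow_lt ((hlvl P hP).1.trans_le ((hbanti P Q hQP).trans (hlvl Q hQ).2)))
  refine ⟨lvl, top, htop, hanti, fun Q hQ => (hab Q hQ).trans (hlvl Q hQ).2, fun R hR => ?_⟩
  have hRS := htop.image_subset hR
  obtain ⟨P, hP, hPa⟩ := Finset.lt_sup_iff.1 (hlvl R hRS).1
  obtain ⟨hPS, hRP⟩ := Finset.mem_filter.1 hP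
  have hl : lvl P = lvl R := le_antisymm (hanti P hPS R hRS hRP)
    (Int.lt_add_one_iff.1
      (lt_of_two_zpow_lt (hPa.trans_le ((hab P hPS).trans (hlvl P hPS).2))))
  obtain ⟨Q, hQ, rfl⟩ := Finset.mem_image.1 hR
  obtain ⟨-, t2, t3, t4⟩ := htop Q hQ
  have e : P = top Q := (t4 P hPS (t2.trans hRP) (hl.trans t3)).antisymm hRP
  rw [e] at hPa
  exact hPa

lemma ENNReal.sum_rpow_mul_rpow_le {ι : Type*} (s : Finset ι) (a H : ι → ℝ≥0∞) {p p' r : ℝ}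
    (hpp : p.HolderConjugate p') (hr : 0 < r) (hrp : r ≤ p') :
    ∑ i ∈ s, a i ^ (1 / p) * H i ^ (1 / r)
      ≤ (∑ i ∈ s, a i) ^ (1 / p) * (∑ i ∈ s, H i) ^ (1 / r) := by
  have hp0 := hpp.pos
  have hp'0 := hpp.symm.pos
  have hd : 0 ≤ 1 / r - 1 / p' := sub_nonneg.2 (one_div_le_one_div_of_le hr hrp)
  have e1 : ∀ (a : ℝ≥0∞) {r : ℝ}, 0 < r → (a ^ (1 / r)) ^ r = a := fun a r hr => by
    rw [← ENNReal.rpow_mul, one_div_mul_cancel hr.ne', ENNReal.rpow_one]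
  have e2 : ∀ x : ℝ≥0∞, x ^ (1 / r) = x ^ (1 / p') * x ^ (1 / r - 1 / p') := fun x => by
    rw [← ENNReal.rpow_add_of_nonneg _ _ (by positivity) hd]
    congr 1
    ring
  calc ∑ i ∈ s, a i ^ (1 / p) * H i ^ (1 / r)
      ≤ ∑ i ∈ s, a i ^ (1 / p) * H i ^ (1 / p') * (∑ i ∈ s, H i) ^ (1 / r - 1 / p') := by
        refine Finset.sum_le_sum fun i hi => ?_
        rw [e2 (H i), ← mul_assoc]
        gcongr
        exact Finset.single_le_sum (f := H) (fun _ _ => zero_le) hi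
    _ ≤ (∑ i ∈ s, a i) ^ (1 / p) * (∑ i ∈ s, H i) ^ (1 / p') *
          (∑ i ∈ s, H i) ^ (1 / r - 1 / p') := by
        rw [← Finset.sum_mul]
        gcongr
        refine (ENNReal.inner_le_Lp_mul_Lq _ _ _ hpp).trans_eq ?_
        simp_rw [e1 _ hp0, e1 _ hp'0]
    _ = _ := by rw [mul_assoc, ← e2]

variable [MeasurableSpace X]

/-- The Carleson embedding for the top sets of a principal decomposition. -/
lemma IsPrincipal.carleson {S : Finset (Set X)} (hS : IsNested S)
    (hm : ∀ Q ∈ S, MeasurableSet Q) {σ : Measure X} {f : X → ℝ≥0∞} (hf : Measurable f)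
    (hft : ∀ Q ∈ S, ∫⁻ x in Q, f x ∂σ ≠ ∞) {lvl : Set X → ℤ} {top : Set X → Set X}
    (h : IsPrincipal S (fun Q => (∫⁻ x in Q, f x ∂σ) / σ Q) lvl top) {p : ℝ} (hp : 1 < p) :
    ∑ R ∈ S.image top, ((2 : ℝ≥0∞) ^ lvl R) ^ p * σ R
      ≤ 2 ^ p * geomConst (p - 1) * ∫⁻ x, f x ^ p ∂σ := by
  have hrp : ∀ x : ℝ≥0∞, x ^ p = x ^ (p - 1) * x := fun x => by
    conv_rhs => rw [← ENNReal.rpow_one x, ← ENNReal.rpow_mul, one_mul]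
    rw [← ENNReal.rpow_add_of_nonneg _ _ (by linarith) zero_le_one]
    congr 1
    ring
  set A : Set X → Set X := fun R => {x | x ∈ R ∧ (2 : ℝ≥0∞) ^ lvl R < 2 * f x} with hA
  have hAm : ∀ R ∈ S, MeasurableSet (A R) := fun R hR =>
    (hm R hR).inter (measurableSet_lt measurable_const (hf.const_mul 2))
  have key : ∀ R ∈ S.image top, (2 : ℝ≥0∞) ^ lvl R * σ R ≤ 2 * ∫⁻ x in A R, f x ∂σ := by
    intro R hR
    have hRS := h.isTopMap.image_subset hR
    have h1 : (2 : ℝ≥0∞) ^ lvl R * σ R ≤ ∫⁻ x in R, f x ∂σ :=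
      ENNReal.mul_le_of_le_div (h.lt R hR).le
    have h2 : 2 * ∫⁻ x in R, f x ∂σ ≤ 2 * (∫⁻ x in A R, f x ∂σ) + (2 : ℝ≥0∞) ^ lvl R * σ R := by
      have e : ∫⁻ x in A R, f x ∂σ = ∫⁻ x in R, (A R).indicator f x ∂σ := by
        rw [lintegral_indicator (hAm R hRS), Measure.restrict_restrict (hAm R hRS),
          inter_eq_self_of_subset_left fun x hx => hx.1]
      rw [e, ← setLIntegral_const, ← lintegral_const_mul _ hf,
        ← lintegral_const_mul _ (hf.indicator (hAm R hRS)),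
        ← lintegral_add_right _ measurable_const]
      refine setLIntegral_mono' (hm R hRS) fun x hx => ?_
      by_cases hxA : x ∈ A R
      · simp [hxA]
      · have : 2 * f x ≤ 2 ^ lvl R := not_lt.1 fun h => hxA ⟨hx, h⟩
        simpa [hxA] using this
    have h3 := h2.trans (add_le_add_right h1 _)
    rw [two_mul (∫⁻ x in R, f x ∂σ)] at h3
    exact h1.trans ((ENNReal.add_le_add_iff_right (hft R hRS)).1 h3)
  calc ∑ R ∈ S.image top, ((2 : ℝ≥0∞) ^ lvl R) ^ p * σ R
      ≤ ∑ R ∈ S.image top, ((2 : ℝ≥0∞) ^ lvl R) ^ (p - 1) * (2 * ∫⁻ x in A R, f x ∂σ) := by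
        refine Finset.sum_le_sum fun R hR => ?_
        rw [hrp, mul_assoc]
        exact mul_le_mul_right (key R hR) _
    _ = ∫⁻ x, ∑ R ∈ S.image top,
          2 * ((A R).indicator (fun _ => ((2 : ℝ≥0∞) ^ lvl R) ^ (p - 1)) x * f x) ∂σ := by
        rw [lintegral_finsetSum]
        · refine Finset.sum_congr rfl fun R hR => ?_
          have hRS := h.isTopMap.image_subset hR
          rw [lintegral_const_mul]
          · have : ∀ x, (A R).indicator (fun _ => ((2 : ℝ≥0∞) ^ lvl R) ^ (p - 1)) x * f x
                = (A R).indicator (fun x => ((2 : ℝ≥0∞) ^ lvl R) ^ (p - 1) * f x) x := by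
              intro x
              by_cases hx : x ∈ A R <;> simp [hx]
            simp_rw [this]
            rw [lintegral_indicator (hAm R hRS), lintegral_const_mul _ hf]
            ring
          · exact (measurable_const.indicator (hAm R hRS)).mul hf
        · intro R hR
          have hRS := h.isTopMap.image_subset hR
          exact ((measurable_const.indicator (hAm R hRS)).mul hf).const_mul _
    _ ≤ ∫⁻ x, 2 ^ p * geomConst (p - 1) * f x ^ p ∂σ := by
        refine lintegral_mono fun x => ?_
        rw [← Finset.mul_sum, ← Finset.sum_mul]
        have h1 : ∑ R ∈ S.image top, (A R).indicator (fun _ => ((2 : ℝ≥0∞) ^ lvl R) ^ (p - 1)) x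
            ≤ geomConst (p - 1) * (2 * f x) ^ (p - 1) := by
          simp only [Set.indicator_apply]
          rw [← Finset.sum_filter]
          refine h.isTopMap.sum_pow_le (x := x) hS (Finset.filter_subset _ _) ?_ ?_ (by linarith)
          · intro R hR
            exact (Finset.mem_filter.1 hR).2.1
          · intro R hR
            exact (Finset.mem_filter.1 hR).2.2.le
        calc 2 * ((∑ R ∈ S.image top,
                (A R).indicator (fun _ => ((2 : ℝ≥0∞) ^ lvl R) ^ (p - 1)) x) * f x)
            ≤ 2 * (geomConst (p - 1) * (2 * f x) ^ (p - 1) * f x) := by gcongr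
          _ = 2 ^ p * geomConst (p - 1) * f x ^ p := by
              rw [hrp (f x), hrp 2, ENNReal.mul_rpow_of_nonneg _ _ (by linarith)]
              ring
    _ = _ := lintegral_const_mul _ (hf.pow_const p)

/-- The constant in the bound for one half of the bilinear form. -/
def halfConst (p q r : ℝ) : ℝ≥0∞ :=
  16 * geomConst (1 / p - 1 / q) * (2 ^ p * geomConst (p - 1)) ^ (1 / p) *
    (2 ^ r * geomConst (r - 1)) ^ (1 / r)

lemma halfConst_lt_top {p q r : ℝ} (hp : 1 < p) (hpq : p < q) (hr : 1 < r) :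
    halfConst p q r < ∞ := by
  have h1 : 0 < 1 / p - 1 / q :=
    sub_pos.2 (one_div_lt_one_div_of_lt (by linarith) hpq)
  have h : ∀ {r : ℝ}, 1 < r → ((2 : ℝ≥0∞) ^ r * geomConst (r - 1)) ^ (1 / r) < ∞ := by
    intro r hr
    refine ENNReal.rpow_lt_top_of_nonneg (by positivity) (ENNReal.mul_lt_top ?_ ?_).ne
    · exact ENNReal.rpow_lt_top_of_nonneg (by linarith) ofNat_ne_top
    · exact geomConst_lt_top (by linarith)
  exact ENNReal.mul_lt_top (ENNReal.mul_lt_top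
    (ENNReal.mul_lt_top (by finiteness) (geomConst_lt_top h1)) (h hp)) (h hr)

lemma half_sum_le {p p' q q' : ℝ} (hpp : p.HolderConjugate p') (hqq : q'.HolderConjugate q)
    (hpq : p < q) {S : Finset (Set X)} (hS : IsNested S) (hm : ∀ Q ∈ S, MeasurableSet Q)
    {lam : Set X → ℝ≥0∞} {σ u : Measure X} {K : ℝ≥0∞} (hK : OuterTesting S lam σ u p q K)
    (hσ : ∀ Q ∈ S, σ Q ≠ 0 ∧ σ Q ≠ ∞) (hu : ∀ Q ∈ S, u Q ≠ 0 ∧ u Q ≠ ∞)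
    {f g : X → ℝ≥0∞} (hf : Measurable f) (hg : Measurable g)
    (hft : ∀ Q ∈ S, ∫⁻ x in Q, f x ∂σ ≠ ∞) (hgt : ∀ Q ∈ S, ∫⁻ x in Q, g x ∂u ≠ ∞)
    {lf lg : Set X → ℤ} {tf tg : Set X → Set X}
    (Hf : IsPrincipal S (fun Q => (∫⁻ x in Q, f x ∂σ) / σ Q) lf tf)
    (Hg : IsPrincipal S (fun Q => (∫⁻ x in Q, g x ∂u) / u Q) lg tg) :
    ∑ Q ∈ S with tg Q ⊆ tf Q, lam Q * (∫⁻ x in Q, f x ∂σ) * ∫⁻ x in Q, g x ∂u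
      ≤ halfConst p q q' * K * (∫⁻ x, f x ^ p ∂σ) ^ (1 / p) * (∫⁻ x, g x ^ q' ∂u) ^ (1 / q') := by
  have hp1 := hpp.lt
  have hp0 := hpp.pos
  have hq0 := hqq.symm.pos
  have hq'1 := hqq.lt
  have hq'0 := hqq.pos
  have hq'p' : q' ≤ p' := by
    have h1 := hqq.inv_add_inv_eq_one
    have h2 := hpp.inv_add_inv_eq_one
    have h3 : q⁻¹ ≤ p⁻¹ := inv_anti₀ hp0 hpq.le
    have h4 : p'⁻¹ ≤ q'⁻¹ := by linarith
    exact (inv_le_inv₀ hpp.symm.pos hq'0).1 h4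
  set A : Set X → Finset (Set X) := fun R => (S.image tg).filter fun G => tf G = R with hA
  have hAS : ∀ R, ∀ G ∈ A R, G ∈ S := fun R G hG =>
    Hg.isTopMap.image_subset (Finset.mem_filter.1 hG).1
  set H : Set X → X → ℝ≥0∞ := fun R x =>
    ∑ G ∈ A R, G.indicator (fun _ => ((2 : ℝ≥0∞) ^ (lg G + 1)) ^ q') x with hH
  have hHm : ∀ R, Measurable (H R) := fun R =>
    Finset.measurable_fun_sum _ fun G hG => measurable_const.indicator (hm G (hAS R G hG))
  set W : Set X → ℝ≥0∞ := fun G => ((2 : ℝ≥0∞) ^ (lg G + 1)) ^ q' * u G with hW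
  have hHint : ∀ R, ∫⁻ x, H R x ∂u = ∑ G ∈ A R, W G := by
    intro R
    rw [hH, lintegral_finsetSum]
    · exact Finset.sum_congr rfl fun G hG => lintegral_indicator_const (hm G (hAS R G hG)) _
    · exact fun G hG => measurable_const.indicator (hm G (hAS R G hG))
  have hWsum : ∑ R ∈ S.image tf, ∑ G ∈ A R, W G
      ≤ 2 ^ q' * (2 ^ q' * geomConst (q' - 1) * ∫⁻ x, g x ^ q' ∂u) := by
    rw [hA, Finset.sum_fiberwise_of_maps_to (s := S.image tg) (t := S.image tf) (g := tf)
      fun G hG => Finset.mem_image_of_mem _ (Hg.isTopMap.image_subset hG)]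
    have : ∀ G, W G = 2 ^ q' * (((2 : ℝ≥0∞) ^ lg G) ^ q' * u G) := fun G => by
      rw [hW]
      simp only
      rw [two_zpow_add_one, ENNReal.mul_rpow_of_nonneg _ _ hq'0.le, mul_assoc]
    simp_rw [this]
    rw [← Finset.mul_sum]
    gcongr
    exact Hg.carleson hS hm hg hgt hq'1
  have hdiv : ∀ a b c : ℝ≥0∞, b ≠ 0 → b ≠ ∞ → a / b ≤ c → a ≤ c * b := fun a b c h0 h1 h =>
    (ENNReal.div_le_iff h0 h1).1 h
  set ε := 1 / p - 1 / q
  calc ∑ Q ∈ S with tg Q ⊆ tf Q, lam Q * (∫⁻ x in Q, f x ∂σ) * ∫⁻ x in Q, g x ∂u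
      = ∑ R ∈ S.image tf, ∑ Q ∈ (S.filter fun Q => tg Q ⊆ tf Q) with tf Q = R,
          lam Q * (∫⁻ x in Q, f x ∂σ) * ∫⁻ x in Q, g x ∂u :=
        (Finset.sum_fiberwise_of_maps_to
          (fun Q hQ => Finset.mem_image_of_mem _ (Finset.mem_filter.1 hQ).1) _).symm
    _ ≤ ∑ R ∈ S.image tf, 2 ^ (lf R + 1) *
          ∑ Q ∈ S with Q ⊆ R, lam Q * σ Q * ∫⁻ x in Q, H R x ^ (1 / q') ∂u := by
        refine Finset.sum_le_sum fun R hR => ?_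
        rw [Finset.mul_sum]
        refine (Finset.sum_le_sum fun Q hQ => ?_).trans
          (Finset.sum_le_sum_of_subset (s := (S.filter fun Q => tg Q ⊆ tf Q).filter
            fun Q => tf Q = R) fun Q hQ => ?_)
        · simp only [Finset.mem_filter] at hQ
          obtain ⟨⟨hQS, hQt⟩, rfl⟩ := hQ
          obtain ⟨f1, f2, f3, f4⟩ := Hf.isTopMap Q hQS
          obtain ⟨g1, g2, g3, g4⟩ := Hg.isTopMap Q hQS
          have b1 : ∫⁻ x in Q, f x ∂σ ≤ 2 ^ (lf (tf Q) + 1) * σ Q := by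
            rw [f3]
            exact hdiv _ _ _ (hσ Q hQS).1 (hσ Q hQS).2 (Hf.le Q hQS)
          have hlev : lf (tg Q) = lf Q :=
            le_antisymm (Hf.anti _ g1 _ hQS g2) (f3 ▸ Hf.anti _ f1 _ g1 hQt)
          obtain ⟨k1, k2, k3, k4⟩ := Hf.isTopMap (tg Q) g1
          have htt : tf (tg Q) = tf Q :=
            (f4 _ k1 (g2.trans k2) (k3.trans hlev)).antisymm
              (k4 _ f1 hQt (f3.trans hlev.symm))
          have b2 : ∫⁻ x in Q, g x ∂u ≤ ∫⁻ x in Q, H (tf Q) x ^ (1 / q') ∂u := by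
            calc ∫⁻ x in Q, g x ∂u ≤ 2 ^ (lg Q + 1) * u Q :=
                  hdiv _ _ _ (hu Q hQS).1 (hu Q hQS).2 (Hg.le Q hQS)
              _ = ∫⁻ x in Q, 2 ^ (lg Q + 1) ∂u := by rw [setLIntegral_const]
              _ ≤ _ := by
                  refine setLIntegral_mono' (hm Q hQS) fun x hx => ?_
                  have : ((2 : ℝ≥0∞) ^ (lg Q + 1)) ^ q' ≤ H (tf Q) x := by
                    have hmem : tg Q ∈ A (tf Q) :=
                      Finset.mem_filter.2 ⟨Finset.mem_image_of_mem _ hQS, htt⟩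
                    refine le_trans ?_ (Finset.single_le_sum
                      (f := fun G : Set X =>
                        G.indicator (fun _ => ((2 : ℝ≥0∞) ^ (lg G + 1)) ^ q') x)
                      (fun _ _ => zero_le) hmem)
                    rw [Set.indicator_of_mem (g2 hx), g3]
                  calc (2 : ℝ≥0∞) ^ (lg Q + 1) = (((2 : ℝ≥0∞) ^ (lg Q + 1)) ^ q') ^ (1 / q') := by
                        rw [← ENNReal.rpow_mul, mul_one_div_cancel hq'0.ne', ENNReal.rpow_one]
                    _ ≤ _ := by gcongr
          calc lam Q * (∫⁻ x in Q, f x ∂σ) * ∫⁻ x in Q, g x ∂u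
              ≤ lam Q * (2 ^ (lf (tf Q) + 1) * σ Q) * ∫⁻ x in Q, H (tf Q) x ^ (1 / q') ∂u := by
                gcongr
            _ = _ := by ring
        · simp only [Finset.mem_filter] at hQ ⊢
          obtain ⟨⟨hQS, hQt⟩, rfl⟩ := hQ
          exact ⟨hQS, (Hf.isTopMap Q hQS).2.1⟩
    _ ≤ ∑ R ∈ S.image tf, 2 ^ (lf R + 1) * (4 * geomConst ε * K * σ R ^ (1 / p) *
          (∑ G ∈ A R, W G) ^ (1 / q')) := by
        refine Finset.sum_le_sum fun R hR => ?_
        have hRS := Hf.isTopMap.image_subset hR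
        refine mul_le_mul_right ((localized_sum_le (h := fun x => H R x ^ (1 / q')) hp1 hpq hqq
          (hS.mono (Finset.filter_subset _ _))
          (fun Q hQ => hm Q (Finset.mem_filter.1 hQ).1)
          (hK.mono hq0 (Finset.filter_subset _ _))
          (fun Q hQ => (hσ Q (Finset.mem_filter.1 hQ).1).1)
          (fun Q hQ => (Finset.mem_filter.1 hQ).2) (hm R hRS) (hσ R hRS).2
          ((hHm R).pow_const _)).trans_eq ?_) _
        simp_rw [← ENNReal.rpow_mul, one_div_mul_cancel hq'0.ne', ENNReal.rpow_one]
        rw [hHint]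
    _ = 8 * geomConst ε * K * ∑ R ∈ S.image tf,
          (((2 : ℝ≥0∞) ^ lf R) ^ p * σ R) ^ (1 / p) * (∑ G ∈ A R, W G) ^ (1 / q') := by
        rw [Finset.mul_sum]
        refine Finset.sum_congr rfl fun R hR => ?_
        rw [ENNReal.mul_rpow_of_nonneg _ _ (by positivity), ← ENNReal.rpow_mul,
          mul_one_div_cancel hp0.ne', ENNReal.rpow_one, two_zpow_add_one]
        ring
    _ ≤ 8 * geomConst ε * K * ((∑ R ∈ S.image tf, ((2 : ℝ≥0∞) ^ lf R) ^ p * σ R) ^ (1 / p) *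
          (∑ R ∈ S.image tf, ∑ G ∈ A R, W G) ^ (1 / q')) := by
        gcongr
        exact ENNReal.sum_rpow_mul_rpow_le _ _ _ hpp hq'0 hq'p'
    _ ≤ 8 * geomConst ε * K * ((2 ^ p * geomConst (p - 1) * ∫⁻ x, f x ^ p ∂σ) ^ (1 / p) *
          (2 ^ q' * (2 ^ q' * geomConst (q' - 1) * ∫⁻ x, g x ^ q' ∂u)) ^ (1 / q')) := by
        gcongr
        exact Hf.carleson hS hm hf hft hp1
    _ = _ := by
        rw [ENNReal.mul_rpow_of_nonneg _ (∫⁻ x, f x ^ p ∂σ) (by positivity),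
          ENNReal.mul_rpow_of_nonneg (2 ^ q') _ (by positivity),
          ENNReal.mul_rpow_of_nonneg _ (∫⁻ x, g x ^ q' ∂u) (by positivity),
          ← ENNReal.rpow_mul, mul_one_div_cancel hq'0.ne', ENNReal.rpow_one, halfConst]
        ring

/-- Two outer testing conditions control the bilinear form of a positive dyadic operator. -/
theorem bilinear_sum_le {p p' q q' : ℝ} (hpp : p.HolderConjugate p') (hqq : q'.HolderConjugate q)
    (hpq : p < q) {S : Finset (Set X)} (hS : IsNested S) (hm : ∀ Q ∈ S, MeasurableSet Q)
    {lam : Set X → ℝ≥0∞} {σ u : Measure X} {K₁ K₂ : ℝ≥0∞}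
    (hK₁ : OuterTesting S lam σ u p q K₁) (hK₂ : OuterTesting S lam u σ q' p' K₂)
    (hσ : ∀ Q ∈ S, σ Q ≠ ∞) (hu : ∀ Q ∈ S, u Q ≠ ∞)
    {f g : X → ℝ≥0∞} (hf : Measurable f) (hg : Measurable g)
    (hft : ∀ Q ∈ S, ∫⁻ x in Q, f x ∂σ ≠ ∞) (hgt : ∀ Q ∈ S, ∫⁻ x in Q, g x ∂u ≠ ∞) :
    ∑ Q ∈ S, lam Q * (∫⁻ x in Q, f x ∂σ) * ∫⁻ x in Q, g x ∂u
      ≤ (halfConst p q q' * K₁ + halfConst q' p' p * K₂) *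
        ((∫⁻ x, f x ^ p ∂σ) ^ (1 / p) * (∫⁻ x, g x ^ q' ∂u) ^ (1 / q')) := by
  have hq'p' : q' < p' := by
    have h1 := hqq.inv_add_inv_eq_one
    have h2 := hpp.inv_add_inv_eq_one
    have h3 : q⁻¹ < p⁻¹ := inv_strictAnti₀ hpp.pos hpq
    have h4 : p'⁻¹ < q'⁻¹ := by linarith
    exact (inv_lt_inv₀ hpp.symm.pos hqq.pos).1 h4
  set T := S.filter fun Q => ∫⁻ x in Q, f x ∂σ ≠ 0 ∧ ∫⁻ x in Q, g x ∂u ≠ 0 with hT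
  have hTS : T ⊆ S := Finset.filter_subset _ _
  have hsum : ∑ Q ∈ S, lam Q * (∫⁻ x in Q, f x ∂σ) * ∫⁻ x in Q, g x ∂u
      = ∑ Q ∈ T, lam Q * (∫⁻ x in Q, f x ∂σ) * ∫⁻ x in Q, g x ∂u := by
    refine (Finset.sum_subset hTS fun Q hQ hQT => ?_).symm
    by_contra hne
    refine hQT (Finset.mem_filter.2 ⟨hQ, fun h => hne ?_, fun h => hne ?_⟩) <;> simp [h]
  have hσT : ∀ Q ∈ T, σ Q ≠ 0 ∧ σ Q ≠ ∞ := fun Q hQ =>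
    ⟨fun h => (Finset.mem_filter.1 hQ).2.1 (setLIntegral_measure_zero _ _ h), hσ Q (hTS hQ)⟩
  have huT : ∀ Q ∈ T, u Q ≠ 0 ∧ u Q ≠ ∞ := fun Q hQ =>
    ⟨fun h => (Finset.mem_filter.1 hQ).2.2 (setLIntegral_measure_zero _ _ h), hu Q (hTS hQ)⟩
  have hne : ∀ Q ∈ T, Q.Nonempty := fun Q hQ => nonempty_of_measure_ne_zero (hσT Q hQ).1
  have hST := hS.mono hTS
  have hmT : ∀ Q ∈ T, MeasurableSet Q := fun Q hQ => hm Q (hTS hQ)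
  obtain ⟨lf, tf, Hf⟩ := hST.exists_principal hne
    (a := fun Q => (∫⁻ x in Q, f x ∂σ) / σ Q)
    (fun Q hQ => (ENNReal.div_pos (Finset.mem_filter.1 hQ).2.1 (hσT Q hQ).2).ne')
    (fun Q hQ => ENNReal.div_ne_top (hft Q (hTS hQ)) (hσT Q hQ).1)
  obtain ⟨lg, tg, Hg⟩ := hST.exists_principal hne
    (a := fun Q => (∫⁻ x in Q, g x ∂u) / u Q)
    (fun Q hQ => (ENNReal.div_pos (Finset.mem_filter.1 hQ).2.2 (huT Q hQ).2).ne')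
    (fun Q hQ => ENNReal.div_ne_top (hgt Q (hTS hQ)) (huT Q hQ).1)
  have B₁ := half_sum_le hpp hqq hpq hST hmT (hK₁.mono hqq.symm.pos hTS) hσT huT hf hg
    (fun Q hQ => hft Q (hTS hQ)) (fun Q hQ => hgt Q (hTS hQ)) Hf Hg
  have B₂ := half_sum_le hqq hpp hq'p' hST hmT (hK₂.mono hpp.symm.pos hTS) huT hσT hg hf
    (fun Q hQ => hgt Q (hTS hQ)) (fun Q hQ => hft Q (hTS hQ)) Hg Hf
  rw [hsum, ← Finset.sum_filter_add_sum_filter_not T fun Q => tg Q ⊆ tf Q, add_mul]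
  refine add_le_add (B₁.trans_eq (by ring)) (le_trans ?_ (B₂.trans_eq (by ring)))
  refine (Finset.sum_le_sum_of_subset (t := T.filter fun Q => tf Q ⊆ tg Q) fun Q hQ => ?_).trans_eq
    (Finset.sum_congr rfl fun Q _ => by ring)
  obtain ⟨hQT, hQ2⟩ := Finset.mem_filter.1 hQ
  obtain ⟨x, hx⟩ := hne Q hQT
  obtain ⟨f1, f2, -⟩ := Hf.isTopMap Q hQT
  obtain ⟨g1, g2, -⟩ := Hg.isTopMap Q hQT
  exact Finset.mem_filter.2 ⟨hQT, (hST.comparable f1 g1 (f2 hx) (g2 hx)).resolve_right hQ2⟩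

end Corona

section Grid

variable {n : ℕ}

/-- The shift, relative to the side length, of the grid at scale `k` in one coordinate. -/
def gridShift (k : ℤ) (b : Bool) : ℝ := if b then (if Even k then 1 / 3 else -(1 / 3)) else 0

/-- The index of the cube at scale `k` of the shifted grid `t` which contains `x`. -/
def gridIndex (t : Fin n → Bool) (k : ℤ) (x : Rn n) : Fin n → ℤ :=
  fun i => ⌊x i / 2 ^ k - gridShift k (t i)⌋

/-- The cubes of the shifted dyadic grid `t`. -/
def gridCube (t : Fin n → Bool) (k : ℤ) (m : Fin n → ℤ) : Cube n where
  corner i := 2 ^ k * (m i + gridShift k (t i))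
  side := 2 ^ k
  side_pos := by positivity

lemma mem_gridCube {t : Fin n → Bool} {k : ℤ} {m : Fin n → ℤ} {x : Rn n} :
    x ∈ (gridCube t k m).set ↔ gridIndex t k x = m := by
  have h2 : (0 : ℝ) < 2 ^ k := by positivity
  rw [funext_iff]
  refine forall_congr' fun i => ?_
  rw [gridIndex, Int.floor_eq_iff, gridCube]
  dsimp only
  rw [le_sub_iff_add_le, le_div_iff₀ h2, sub_lt_iff_lt_add, div_lt_iff₀ h2]
  constructor <;> rintro ⟨h, h'⟩ <;> constructor <;> nlinarith

lemma mem_gridCube_gridIndex (t : Fin n → Bool) (k : ℤ) (x : Rn n) :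
    x ∈ (gridCube t k (gridIndex t k x)).set := mem_gridCube.2 rfl

lemma exists_gridShift_eq (k : ℤ) (b : Bool) :
    ∃ c : ℤ, 2 * gridShift (k + 1) b - gridShift k b = c := by
  unfold gridShift
  cases b
  · exact ⟨0, by simp⟩
  · by_cases hk : Even k
    · have hk' : ¬Even (k + 1) := Int.even_add_one.not.2 (not_not.2 hk)
      exact ⟨-1, by simp only [if_true, if_pos hk, if_neg hk']; norm_num⟩
    · have hk' : Even (k + 1) := Int.even_add_one.2 hk
      exact ⟨1, by simp only [if_true, if_neg hk, if_pos hk']; norm_num⟩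

lemma gridIndex_succ_congr {t : Fin n → Bool} {k : ℤ} {x y : Rn n}
    (h : gridIndex t k x = gridIndex t k y) : gridIndex t (k + 1) x = gridIndex t (k + 1) y := by
  funext i
  obtain ⟨c, hc⟩ := exists_gridShift_eq k (t i)
  have key : ∀ z : Rn n, gridIndex t (k + 1) z i = (gridIndex t k z i - c) / 2 := by
    intro z
    have h2 : (0 : ℝ) < 2 ^ k := by positivity
    have e : z i / 2 ^ (k + 1) - gridShift (k + 1) (t i)
        = (z i / 2 ^ k - gridShift k (t i) - c) / (2 : ℕ) := by
      rw [← hc, zpow_add_one₀ two_ne_zero]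
      field_simp
      push_cast
      ring
    unfold gridIndex
    rw [e, Int.floor_div_natCast, Int.floor_sub_intCast]
    rfl
  rw [key, key, h]

lemma gridIndex_congr {t : Fin n → Bool} {k l : ℤ} (hkl : k ≤ l) {x y : Rn n}
    (h : gridIndex t k x = gridIndex t k y) : gridIndex t l x = gridIndex t l y := by
  induction l, hkl using Int.leInduction with
  | base => exact h
  | succ j _ ih => exact gridIndex_succ_congr ih

lemma gridCube_subset {t : Fin n → Bool} {k l : ℤ} (hkl : k ≤ l) (x : Rn n) :
    (gridCube t k (gridIndex t k x)).set ⊆ (gridCube t l (gridIndex t l x)).set := fun _ hy =>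
  mem_gridCube.2 (gridIndex_congr hkl (mem_gridCube.1 hy))

lemma Cube.set_eq_pi (Q : Cube n) :
    Q.set = Set.pi univ fun i => Ico (Q.corner i) (Q.corner i + Q.side) := by
  ext x
  simp [Cube.set]

lemma Cube.measurableSet (Q : Cube n) : MeasurableSet Q.set := by
  rw [Q.set_eq_pi]
  exact MeasurableSet.univ_pi fun i => measurableSet_Ico

lemma Cube.volume_set (Q : Cube n) : volume Q.set = ENNReal.ofReal Q.vol := by
  rw [Q.set_eq_pi, volume_pi_pi]
  simp [Cube.vol, ENNReal.ofReal_pow Q.side_pos.le]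

lemma Cube.vol_pos (Q : Cube n) : 0 < Q.vol := pow_pos Q.side_pos n

lemma ofReal_two_zpow (k : ℤ) : ENNReal.ofReal ((2 : ℝ) ^ k) = 2 ^ k := by
  rw [← Real.rpow_intCast, ← ENNReal.ofReal_rpow_of_pos two_pos, ENNReal.rpow_intCast]
  simp

lemma volume_gridCube (t : Fin n → Bool) (k : ℤ) (m : Fin n → ℤ) :
    volume (gridCube t k m).set = ((2 : ℝ≥0∞) ^ k) ^ n := by
  rw [Cube.volume_set, Cube.vol, ENNReal.ofReal_pow (Cube.side_pos _).le, gridCube, ofReal_two_zpow]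

/-- The shifted dyadic grid `t`, as a family of sets. -/
def gridSets (t : Fin n → Bool) : Set (Set (Rn n)) :=
  range fun a : ℤ × (Fin n → ℤ) => (gridCube t a.1 a.2).set

lemma countable_gridSets (t : Fin n → Bool) : (gridSets t).Countable := countable_range _

lemma eq_gridCube {t : Fin n → Bool} {P : Set (Rn n)} (hP : P ∈ gridSets t) {x : Rn n}
    (hx : x ∈ P) : ∃ k, P = (gridCube t k (gridIndex t k x)).set := by
  obtain ⟨⟨k, m⟩, rfl⟩ := hP
  exact ⟨k, by rw [mem_gridCube.1 hx]⟩

lemma measurableSet_of_mem_gridSets {t : Fin n → Bool} {P : Set (Rn n)} (hP : P ∈ gridSets t) :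
    MeasurableSet P := by
  obtain ⟨a, rfl⟩ := hP
  exact Cube.measurableSet _

lemma gridSets_nested {t : Fin n → Bool} {P Q : Set (Rn n)} (hP : P ∈ gridSets t)
    (hQ : Q ∈ gridSets t) : P ⊆ Q ∨ Q ⊆ P ∨ Disjoint P Q := by
  by_cases h : Disjoint P Q
  · exact Or.inr (Or.inr h)
  · obtain ⟨x, hxP, hxQ⟩ := Set.not_disjoint_iff.1 h
    obtain ⟨k, rfl⟩ := eq_gridCube hP hxP
    obtain ⟨l, rfl⟩ := eq_gridCube hQ hxQ
    rcases le_total k l with h | h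
    · exact Or.inl (gridCube_subset h x)
    · exact Or.inr (Or.inl (gridCube_subset h x))

/-- Nearby reals share an interval of one of two shifted grids. -/
lemma exists_gridShift_floor_eq (k : ℤ) {a b : ℝ} (h : |a - b| ≤ 1 / 3) :
    ∃ t : Bool, ⌊a - gridShift k t⌋ = ⌊b - gridShift k t⌋ := by
  wlog hab : a ≤ b generalizing a b
  · obtain ⟨t, ht⟩ := this (by rwa [abs_sub_comm]) (le_of_not_ge hab)
    exact ⟨t, ht.symm⟩
  by_cases hf : ⌊a⌋ = ⌊b⌋
  · exact ⟨false, by simpa [gridShift] using hf⟩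
  · have h1 : ⌊a⌋ < ⌊b⌋ := lt_of_le_of_ne (Int.floor_mono hab) hf
    have h2 := Int.floor_lt.1 h1
    have h3 := Int.floor_le b
    have h4 := abs_le.1 h
    refine ⟨true, ?_⟩
    by_cases hk : Even k
    · have e : ∀ z : ℝ, z - gridShift k true = z - 1 / 3 := fun z => by simp [gridShift, hk]
      rw [e, e]
      trans ⌊b⌋ - 1
      · rw [Int.floor_eq_iff]
        push_cast
        constructor <;> linarith
      · symm
        rw [Int.floor_eq_iff]
        push_cast
        constructor <;> linarith
    · have e : ∀ z : ℝ, z - gridShift k true = z + 1 / 3 := fun z => by simp [gridShift, hk]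
      rw [e, e]
      trans ⌊b⌋
      · rw [Int.floor_eq_iff]
        constructor <;> linarith
      · symm
        rw [Int.floor_eq_iff]
        constructor <;> linarith

lemma exists_gridIndex_eq (k : ℤ) {x y : Rn n} (h : ∀ i, |x i - y i| ≤ 2 ^ k / 3) :
    ∃ t : Fin n → Bool, gridIndex t k x = gridIndex t k y := by
  have h2 : (0 : ℝ) < 2 ^ k := by positivity
  have : ∀ i, ∃ b : Bool, ⌊x i / 2 ^ k - gridShift k b⌋ = ⌊y i / 2 ^ k - gridShift k b⌋ := by
    intro i
    refine exists_gridShift_floor_eq k ?_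
    rw [← sub_div, abs_div, abs_of_pos h2, div_le_iff₀ h2]
    linarith [h i]
  choose t ht using this
  exact ⟨t, funext ht⟩

lemma abs_le_eucNorm (x : Rn n) (i : Fin n) : |x i| ≤ eucNorm x := by
  unfold eucNorm
  rw [← Real.sqrt_sq_eq_abs]
  exact Real.sqrt_le_sqrt (Finset.single_le_sum (f := fun i => x i ^ 2)
    (fun i _ => sq_nonneg _) (Finset.mem_univ i))

/-- The coefficient of a cube in the dyadic Riesz potential. -/
def gridCoeff (n : ℕ) (α : ℝ) (P : Set (Rn n)) : ℝ≥0∞ := volume P ^ (α / n - 1)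

lemma gridCoeff_gridCube (hn : 0 < n) (α : ℝ) (t : Fin n → Bool) (k : ℤ) (m : Fin n → ℤ) :
    gridCoeff n α (gridCube t k m).set = ((2 : ℝ≥0∞) ^ k) ^ (α - n) := by
  have hn' : (n : ℝ) ≠ 0 := by positivity
  rw [gridCoeff, volume_gridCube, ← ENNReal.rpow_natCast, ← ENNReal.rpow_mul]
  congr 1
  field_simp

/-- The kernel of the Riesz potential is dominated by the coefficient of a common grid cube. -/
lemma exists_grid_kernel_le (hn : 0 < n) {α : ℝ} (hαn : α < n) {x y : Rn n} (hxy : x ≠ y) :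
    ∃ t : Fin n → Bool, ∃ P ∈ gridSets t, x ∈ P ∧ y ∈ P ∧
      ENNReal.ofReal (eucNorm (x - y) ^ (α - n)) ≤ 6 ^ (n - α) * gridCoeff n α P := by
  obtain ⟨i₀, hi₀⟩ : ∃ i, x i ≠ y i := by
    by_contra! h
    exact hxy (funext h)
  have : Nonempty (Fin n) := ⟨i₀⟩
  obtain ⟨j, -, hj⟩ := Finset.exists_max_image Finset.univ (fun i => |x i - y i|) ⟨i₀, by simp⟩
  set d := |x j - y j|
  have hd : 0 < d := (abs_pos.2 (sub_ne_zero.2 hi₀)).trans_le (hj i₀ (Finset.mem_univ _))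
  obtain ⟨k, hk1, hk2⟩ := exists_mem_Ioc_zpow (show 0 < 3 * d by positivity) one_lt_two
  obtain ⟨t, ht⟩ := exists_gridIndex_eq (k + 1) (x := x) (y := y) fun i => by
    have := hj i (Finset.mem_univ _)
    linarith
  refine ⟨t, (gridCube t (k + 1) (gridIndex t (k + 1) x)).set, ⟨(_, _), rfl⟩,
    mem_gridCube_gridIndex _ _ _, mem_gridCube.2 ht.symm, ?_⟩
  rw [gridCoeff_gridCube hn, ← ofReal_two_zpow]
  have h2 : (0 : ℝ) < 2 ^ (k + 1) := by positivity
  have hE : (2 : ℝ) ^ (k + 1) / 6 ≤ eucNorm (x - y) := by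
    refine le_trans ?_ (abs_le_eucNorm (x - y) j)
    rw [zpow_add_one₀ two_ne_zero, Pi.sub_apply]
    change _ ≤ d
    linarith
  have h6 : (6 : ℝ≥0∞) ^ (n - α) = ENNReal.ofReal (6 ^ (n - α)) := by
    rw [← ENNReal.ofReal_rpow_of_pos (by norm_num)]
    simp
  rw [ENNReal.ofReal_rpow_of_pos h2, h6, ← ENNReal.ofReal_mul (by positivity)]
  refine ENNReal.ofReal_le_ofReal ?_
  calc eucNorm (x - y) ^ (α - n) ≤ ((2 : ℝ) ^ (k + 1) / 6) ^ (α - n) :=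
        Real.rpow_le_rpow_of_nonpos (by positivity) hE (by linarith)
    _ = _ := by
        rw [Real.div_rpow h2.le (by norm_num), show α - n = -(n - α) by ring,
          Real.rpow_neg (by norm_num : (0 : ℝ) ≤ 6), Real.rpow_neg h2.le]
        field_simp

end Grid

section Bump

variable {n : ℕ}

lemma IsYoung.mul_le {Φ : ℝ → ℝ} (hΦ : IsYoung Φ) {s t : ℝ} (hs : 0 < s) (ht : 0 ≤ t) :
    s * t ≤ Φ s + assocFn Φ t := by
  obtain ⟨-, -, hmono, h0, hlim⟩ := hΦ
  have hpos : ∀ r, 0 < r → 0 < Φ r := fun r hr => by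
    have := hmono (mem_Ici.2 le_rfl) (mem_Ici.2 hr.le) hr
    rwa [h0] at this
  obtain ⟨N, hN⟩ := (hlim.eventually_ge_atTop t).exists_forall_of_atTop
  have hb : BddAbove {y : ℝ | ∃ s : ℝ, 0 < s ∧ y = s * t - Φ s} := by
    refine ⟨max 0 (N * t), ?_⟩
    rintro y ⟨r, hr, rfl⟩
    rcases le_total N r with h | h
    · refine le_max_of_le_left ?_
      have := (le_div_iff₀ hr).1 (hN r h)
      linarith
    · refine le_max_of_le_right ?_
      have := mul_le_mul_of_nonneg_right h ht
      linarith [hpos r hr]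
  have : s * t - Φ s ≤ assocFn Φ t := le_csSup hb ⟨s, hs, rfl⟩
  linarith

lemma IsYoung.ofReal_mul_le {Φ : ℝ → ℝ} (hΦ : IsYoung Φ) {s t : ℝ} (hs : 0 ≤ s) (ht : 0 ≤ t) :
    ENNReal.ofReal (s * t) ≤ ENNReal.ofReal (Φ s) + ENNReal.ofReal (assocFn Φ t) := by
  rcases hs.eq_or_lt with rfl | hs
  · simp
  · exact (ENNReal.ofReal_le_ofReal (hΦ.mul_le hs ht)).trans ENNReal.ofReal_add_le

lemma IsYoung.measurable_comp {Φ : ℝ → ℝ} (hΦ : IsYoung Φ) {f : Rn n → ℝ} (hf : Measurable f)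
    {l : ℝ} (hl : 0 < l) : Measurable fun x => ENNReal.ofReal (Φ (|f x| / l)) := by
  have hc : Continuous fun y : ℝ => Φ |y| :=
    continuousOn_univ.1 (hΦ.1.comp continuous_abs.continuousOn fun x _ => abs_nonneg x)
  have e : (fun x => ENNReal.ofReal (Φ (|f x| / l)))
      = fun x => ENNReal.ofReal ((fun y : ℝ => Φ |y|) (f x / l)) := by
    funext x
    simp [abs_div, abs_of_pos hl]
  rw [e]
  exact (hc.measurable.comp (hf.div_const l)).ennreal_ofReal

lemma exists_of_luxNorm_lt {Φ : ℝ → ℝ} {Q : Cube n} {f : Rn n → ℝ} {c : ℝ≥0∞}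
    (h : luxNorm Φ Q f < c) : ∃ l : ℝ, 0 < l ∧ ENNReal.ofReal l < c ∧
      (∫⁻ x in Q.set, ENNReal.ofReal (Φ (|f x| / l))) ≤ ENNReal.ofReal Q.vol := by
  obtain ⟨_, ⟨l, hl, rfl⟩, hlc⟩ := sInf_lt_iff.1 h
  exact ⟨l, hl.1, hlc, hl.2⟩

/-- Hölder's inequality for Luxemburg averages. -/
lemma IsYoung.lintegral_mul_le {Φ : ℝ → ℝ} (hΦ : IsYoung Φ) (Q : Cube n) {a b : Rn n → ℝ}
    (ha : Measurable a) (h0 : luxNorm Φ Q a ≠ 0) (h1 : luxNorm Φ Q a ≠ ∞) :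
    ∫⁻ x in Q.set, ENNReal.ofReal (|a x| * |b x|)
      ≤ 2 * ENNReal.ofReal Q.vol * (luxNorm Φ Q a * luxNorm (assocFn Φ) Q b) := by
  have hV0 : 2 * ENNReal.ofReal Q.vol ≠ 0 :=
    mul_ne_zero two_ne_zero (ENNReal.ofReal_pos.2 Q.vol_pos).ne'
  have hVt : 2 * ENNReal.ofReal Q.vol ≠ ∞ := ENNReal.mul_ne_top ofNat_ne_top ENNReal.ofReal_ne_top
  rw [mul_comm, ← ENNReal.div_le_iff hV0 hVt]
  refine ENNReal.le_mul_of_forall_lt (Or.inl h0) (Or.inl h1) fun c hc d hd => ?_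
  obtain ⟨l, hl, hlc, hla⟩ := exists_of_luxNorm_lt hc
  obtain ⟨m, hm, hmd, hmb⟩ := exists_of_luxNorm_lt hd
  refine le_trans ?_ (mul_le_mul' hlc.le hmd.le)
  rw [ENNReal.div_le_iff hV0 hVt, ← ENNReal.ofReal_mul hl.le]
  calc ∫⁻ x in Q.set, ENNReal.ofReal (|a x| * |b x|)
      = ∫⁻ x in Q.set, ENNReal.ofReal (l * m) *
          ENNReal.ofReal (|a x| / l * (|b x| / m)) := by
        refine lintegral_congr fun x => ?_
        rw [← ENNReal.ofReal_mul (by positivity)]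
        congr 1
        field_simp
    _ ≤ ∫⁻ x in Q.set, ENNReal.ofReal (l * m) * (ENNReal.ofReal (Φ (|a x| / l)) +
          ENNReal.ofReal (assocFn Φ (|b x| / m))) := by
        gcongr with x
        exact hΦ.ofReal_mul_le (by positivity) (by positivity)
    _ ≤ ENNReal.ofReal (l * m) * (ENNReal.ofReal Q.vol + ENNReal.ofReal Q.vol) := by
        rw [lintegral_const_mul' _ _ ENNReal.ofReal_ne_top,
          lintegral_add_left (hΦ.measurable_comp ha hl)]
        gcongr
    _ = _ := by rw [two_mul]

lemma IsYoung.lintegral_eq_zero {Φ : ℝ → ℝ} (hΦ : IsYoung Φ) (Q : Cube n) {a : Rn n → ℝ}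
    (ha : Measurable a) (h0 : luxNorm Φ Q a = 0) :
    ∫⁻ x in Q.set, ENNReal.ofReal |a x| = 0 := by
  set D : ℝ≥0∞ := ENNReal.ofReal Q.vol + ENNReal.ofReal (assocFn Φ 1) * ENNReal.ofReal Q.vol
  have hDt : D ≠ ∞ := ENNReal.add_ne_top.2
    ⟨ENNReal.ofReal_ne_top, ENNReal.mul_ne_top ENNReal.ofReal_ne_top ENNReal.ofReal_ne_top⟩
  have hD0 : D ≠ 0 := ((ENNReal.ofReal_pos.2 Q.vol_pos).trans_le le_self_add).ne'
  have key : ∀ c : ℝ≥0∞, 0 < c → (∫⁻ x in Q.set, ENNReal.ofReal |a x|) ≤ c * D := by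
    intro c hc
    obtain ⟨l, hl, hlc, hla⟩ := exists_of_luxNorm_lt (h0.trans_lt hc)
    calc ∫⁻ x in Q.set, ENNReal.ofReal |a x|
        = ∫⁻ x in Q.set, ENNReal.ofReal l * ENNReal.ofReal (|a x| / l * 1) := by
          refine lintegral_congr fun x => ?_
          rw [← ENNReal.ofReal_mul hl.le]
          congr 1
          field_simp
      _ ≤ ∫⁻ x in Q.set, ENNReal.ofReal l * (ENNReal.ofReal (Φ (|a x| / l)) +
          ENNReal.ofReal (assocFn Φ 1)) := by
          gcongr with x
          exact hΦ.ofReal_mul_le (by positivity) zero_le_one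
      _ ≤ ENNReal.ofReal l * D := by
          rw [lintegral_const_mul' _ _ ENNReal.ofReal_ne_top,
            lintegral_add_left (hΦ.measurable_comp ha hl), setLIntegral_const, Q.volume_set]
          exact mul_le_mul' le_rfl (add_le_add hla le_rfl)
      _ ≤ c * D := by gcongr
  refine le_antisymm ?_ zero_le
  refine le_of_forall_gt_imp_ge_of_dense fun e he => ?_
  refine (key (e / D) (ENNReal.div_pos he.ne' hDt)).trans_eq (ENNReal.div_mul_cancel hD0 hDt)

/-- The measure `w dx` of a weight. -/
def weightMeasure (w : Rn n → ℝ) : Measure (Rn n) :=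
  volume.withDensity fun x => ENNReal.ofReal (w x)

lemma bump_cube_le {α β p q : ℝ} (hn : 0 < n) (hp : 1 < p) (hq : 0 < q)
    (hβ : β = n * (1 / p - 1 / q)) {Φ : ℝ → ℝ} (hΦ : IsYoung Φ) {u σ : Rn n → ℝ}
    (hσm : Measurable σ) (hσ0 : ∀ x, 0 ≤ σ x)
    (hA : bumpA α p q Φ u σ < ∞) (P : Cube n) {Q : Set (Rn n)} (hQm : MeasurableSet Q)
    (hQP : Q ⊆ P.set) :
    ENNReal.ofReal (P.vol ^ (α / n - 1)) * weightMeasure u P.set ^ (1 / q) * weightMeasure σ Q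
      ≤ 2 * bumpA α p q Φ u σ * (ENNReal.ofReal (P.vol ^ (1 / q)) *
        (ENNReal.ofReal (P.vol ^ (β / n)) *
          luxNorm (assocFn Φ) P (Q.indicator fun x => σ x ^ (1 / p)))) := by
  have hV := P.vol_pos
  have hn' : (n : ℝ) ≠ 0 := by positivity
  have hp0 : 0 < p := by linarith
  have hpc : 1 / conjExp p = 1 - 1 / p := by
    unfold conjExp
    field_simp
  have hpc0 : 0 < 1 / conjExp p := by
    rw [hpc, sub_pos, div_lt_one hp0]
    exact hp
  have hW : ∀ w : Rn n → ℝ, weightMeasure w P.set = avgW P w * ENNReal.ofReal P.vol := by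
    intro w
    rw [weightMeasure, withDensity_apply _ P.measurableSet, avgW, avgE,
      ENNReal.div_mul_cancel (ENNReal.ofReal_pos.2 hV).ne' ENNReal.ofReal_ne_top]
  set a : Rn n → ℝ := fun x => σ x ^ (1 / conjExp p) with ha
  have ham : Measurable a := hσm.pow_const _
  have hAP : ENNReal.ofReal (P.vol ^ (α / n + 1 / q - 1 / p)) * avgW P u ^ (1 / q) *
      luxNorm Φ P a ≤ bumpA α p q Φ u σ :=
    le_iSup (fun Q : Cube n => ENNReal.ofReal (Q.vol ^ (α / n + 1 / q - 1 / p)) *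
      avgW Q u ^ (1 / q) * luxNorm Φ Q fun x => σ x ^ (1 / conjExp p)) P
  by_cases hu : weightMeasure u P.set = 0
  · simp [hu, hq]
  by_cases hσQ : weightMeasure σ Q = 0
  · simp [hσQ]
  have hl0 : luxNorm Φ P a ≠ 0 := by
    intro h
    have h2 := hΦ.lintegral_eq_zero P ham h
    rw [lintegral_eq_zero_iff (by fun_prop)] at h2
    refine hσQ (measure_mono_null hQP ?_)
    rw [weightMeasure, withDensity_apply _ P.measurableSet, lintegral_eq_zero_iff (by fun_prop)]
    filter_upwards [h2] with x hx
    have h3 : a x = 0 := by simpa using hx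
    have h4 := (Real.rpow_eq_zero (hσ0 x) hpc0.ne').1 h3
    simp [h4]
  have hlt : luxNorm Φ P a ≠ ∞ := by
    intro h
    rw [h, ENNReal.mul_top] at hAP
    · exact absurd hAP (not_le.2 hA)
    · refine mul_ne_zero (ENNReal.ofReal_pos.2 (by positivity)).ne' ?_
      intro h0
      rw [ENNReal.rpow_eq_zero_iff_of_pos (by positivity)] at h0
      rw [hW, h0, zero_mul] at hu
      exact hu rfl
  have hσle : weightMeasure σ Q ≤ 2 * ENNReal.ofReal P.vol * (luxNorm Φ P a *
      luxNorm (assocFn Φ) P (Q.indicator fun x => σ x ^ (1 / p))) := by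
    refine le_trans (le_of_eq ?_) (hΦ.lintegral_mul_le P ham hl0 hlt)
    rw [weightMeasure, withDensity_apply _ hQm, ← lintegral_indicator hQm,
      ← lintegral_indicator P.measurableSet]
    refine lintegral_congr fun x => ?_
    by_cases hx : x ∈ Q
    · rw [indicator_of_mem hx, indicator_of_mem (hQP hx), indicator_of_mem hx,
        abs_of_nonneg (Real.rpow_nonneg (hσ0 x) _), abs_of_nonneg (Real.rpow_nonneg (hσ0 x) _),
        ← Real.rpow_add_of_nonneg (hσ0 x) hpc0.le (by positivity), hpc, sub_add_cancel,
        Real.rpow_one]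
    · rw [indicator_of_notMem hx]
      by_cases hxP : x ∈ P.set
      · simp [indicator_of_mem hxP, indicator_of_notMem hx]
      · simp [indicator_of_notMem hxP]
  set L := luxNorm (assocFn Φ) P (Q.indicator fun x => σ x ^ (1 / p))
  have hpow : ∀ r : ℝ, ENNReal.ofReal (P.vol ^ r) = ENNReal.ofReal P.vol ^ r := fun r =>
    (ENNReal.ofReal_rpow_of_pos hV).symm
  have hv0 : ENNReal.ofReal P.vol ≠ 0 := (ENNReal.ofReal_pos.2 hV).ne'
  have hvt : ENNReal.ofReal P.vol ≠ ∞ := ENNReal.ofReal_ne_top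
  rw [hpow] at hAP
  rw [hpow, hpow, hpow, hW, ENNReal.mul_rpow_of_nonneg _ _ (by positivity)]
  set v := ENNReal.ofReal P.vol
  calc v ^ (α / n - 1) * (avgW P u ^ (1 / q) * v ^ (1 / q)) * weightMeasure σ Q
      ≤ v ^ (α / n - 1) * (avgW P u ^ (1 / q) * v ^ (1 / q)) *
        (2 * v * (luxNorm Φ P a * L)) := by gcongr
    _ = (2 * (v ^ (α / n - 1) * v ^ (1 / q) * v ^ (1 : ℝ))) *
        (avgW P u ^ (1 / q) * luxNorm Φ P a * L) := by
        rw [ENNReal.rpow_one]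
        ring
    _ = (2 * (v ^ (α / n + 1 / q - 1 / p) * v ^ (1 / q) * v ^ (β / n))) *
        (avgW P u ^ (1 / q) * luxNorm Φ P a * L) := by
        rw [← ENNReal.rpow_add _ _ hv0 hvt, ← ENNReal.rpow_add _ _ hv0 hvt,
          ← ENNReal.rpow_add _ _ hv0 hvt, ← ENNReal.rpow_add _ _ hv0 hvt, hβ]
        congr 3
        field_simp
        ring
    _ = 2 * (v ^ (α / n + 1 / q - 1 / p) * avgW P u ^ (1 / q) * luxNorm Φ P a) *
        (v ^ (1 / q) * (v ^ (β / n) * L)) := by ring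
    _ ≤ _ := by gcongr

end Bump

section GridTesting

open scoped Classical

variable {n : ℕ}

lemma chainSum_rpow_le (hn : 0 < n) {α q : ℝ} (hαn : α < n) (hq : 0 < q) {t : Fin n → Bool}
    {S : Finset (Set (Rn n))} {Q : Set (Rn n)} {κ : Set (Rn n) → ℤ} {x₀ : Rn n}
    (hκ : ∀ P ∈ S.filter (Q ⊆ ·), P = (gridCube t (κ P) (gridIndex t (κ P) x₀)).set) (x : Rn n) :
    chainSum S (gridCoeff n α) Q x ^ q ≤ geomConst (n - α) ^ q *
      ∑ P ∈ S with Q ⊆ P, P.indicator (fun _ => gridCoeff n α P ^ q) x := by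
  set T := (S.filter (Q ⊆ ·)).filter (x ∈ ·) with hT
  have hsum : ∀ c : Set (Rn n) → ℝ≥0∞,
      ∑ P ∈ S with Q ⊆ P, P.indicator (fun _ => c P) x = ∑ P ∈ T, c P := fun c => by
    rw [hT, Finset.sum_filter (x ∈ ·)]
    rfl
  have hlam : ∀ P ∈ T, gridCoeff n α P = ((2 : ℝ≥0∞) ^ (-κ P)) ^ (n - α) := fun P hP => by
    conv_lhs => rw [hκ P (Finset.mem_filter.1 hP).1]
    rw [gridCoeff_gridCube hn, ENNReal.zpow_neg, ENNReal.inv_rpow, ← ENNReal.rpow_neg, neg_sub]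
  rw [chainSum, hsum, hsum fun P => gridCoeff n α P ^ q]
  rcases T.eq_empty_or_nonempty with h | h
  · simp [h, hq]
  obtain ⟨P₀, hP₀, hmin⟩ := T.exists_min_image κ h
  have hinj : Set.InjOn (fun P => -κ P) T := by
    intro P hP R hR hPR
    have e : κ P = κ R := neg_injective hPR
    rw [hκ P (Finset.mem_filter.1 hP).1, hκ R (Finset.mem_filter.1 hR).1, e]
  calc (∑ P ∈ T, gridCoeff n α P) ^ q
      = (∑ i ∈ T.image fun P => -κ P, ((2 : ℝ≥0∞) ^ i) ^ (n - α)) ^ q := by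
        rw [Finset.sum_image hinj, Finset.sum_congr rfl hlam]
    _ ≤ (geomConst (n - α) * ((2 : ℝ≥0∞) ^ (-κ P₀)) ^ (n - α)) ^ q := by
        gcongr
        refine sum_zpow_rpow_le _ (fun i hi => ?_) (by linarith)
        obtain ⟨P, hP, rfl⟩ := Finset.mem_image.1 hi
        exact two_zpow_le (neg_le_neg (hmin P hP))
    _ = geomConst (n - α) ^ q * gridCoeff n α P₀ ^ q := by
        rw [ENNReal.mul_rpow_of_nonneg _ _ hq.le, hlam P₀ hP₀]
    _ ≤ _ := by
        gcongr
        exact Finset.single_le_sum (f := fun P => gridCoeff n α P ^ q) (fun _ _ => zero_le) hP₀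

/-- Along a chain of grid cubes, averages are controlled by the maximal function. -/
lemma sum_volume_mul_rpow_le (hn : 0 < n) {q : ℝ} (hq : 0 < q) {t : Fin n → Bool} {x₀ : Rn n}
    (I : Finset ℤ) (c : ℤ → ℝ≥0∞) (M : Rn n → ℝ≥0∞)
    (hM : ∀ k ∈ I, ∀ x ∈ (gridCube t k (gridIndex t k x₀)).set, c k ≤ M x) :
    ∑ k ∈ I, volume (gridCube t k (gridIndex t k x₀)).set * c k ^ q ≤ 2 * ∫⁻ x, M x ^ q := by
  set G : ℤ → Set (Rn n) := fun k => (gridCube t k (gridIndex t k x₀)).set with hG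
  have hGm : ∀ k, MeasurableSet (G k) := fun k => Cube.measurableSet _
  have hGsub : ∀ k l, k ≤ l → G k ⊆ G l := fun k l h => gridCube_subset h x₀
  set E : ℤ → Set (Rn n) := fun k => G k \ G (k - 1) with hE
  have hEm : ∀ k, MeasurableSet (E k) := fun k => (hGm k).diff (hGm _)
  have hdisj : ∀ k l, k < l → Disjoint (E k) (E l) := fun k l h =>
    Set.disjoint_left.2 fun x hx hx' => hx'.2 (hGsub k (l - 1) (by omega) hx.1)
  have hpd : Set.PairwiseDisjoint (I : Set ℤ) E := fun k _ l _ h => by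
    rcases lt_or_gt_of_ne h with h | h
    · exact hdisj k l h
    · exact (hdisj l k h).symm
  have hvol : ∀ k, volume (G k) ≤ 2 * volume (E k) := by
    intro k
    have h1 : volume (G (k - 1)) ≠ ∞ := by
      rw [hG, Cube.volume_set]
      exact ENNReal.ofReal_ne_top
    have h2 : 2 * volume (G (k - 1)) ≤ volume (G k) := by
      simp only [hG, volume_gridCube]
      obtain ⟨m, rfl⟩ := Nat.exists_eq_succ_of_ne_zero hn.ne'
      have : (2 : ℝ≥0∞) ^ k = 2 * 2 ^ (k - 1) := by
        rw [← two_zpow_add_one, sub_add_cancel]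
      rw [this, mul_pow]
      gcongr
      exact le_self_pow₀ one_le_two (by simp)
    have h3 : volume (G k) ≤ volume (E k) + volume (G (k - 1)) := by
      refine (measure_mono ?_).trans (measure_union_le _ _)
      intro x hx
      by_cases hx' : x ∈ G (k - 1)
      · exact Or.inr hx'
      · exact Or.inl ⟨hx, hx'⟩
    have h4 : volume (G (k - 1)) ≤ volume (E k) := by
      rw [two_mul] at h2
      exact (ENNReal.add_le_add_iff_right h1).1 (h2.trans h3)
    rw [two_mul]
    exact h3.trans (add_le_add le_rfl h4)
  calc ∑ k ∈ I, volume (G k) * c k ^ q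
      ≤ ∑ k ∈ I, 2 * ∫⁻ x in E k, M x ^ q := by
        refine Finset.sum_le_sum fun k hk => ?_
        calc volume (G k) * c k ^ q ≤ 2 * volume (E k) * c k ^ q := by gcongr; exact hvol k
          _ = 2 * ∫⁻ x in E k, c k ^ q := by rw [setLIntegral_const]; ring
          _ ≤ _ := by
            refine mul_le_mul' le_rfl (setLIntegral_mono' (hEm k) fun x hx => ?_)
            exact ENNReal.rpow_le_rpow (hM k hk x hx.1) hq.le
    _ = 2 * ∫⁻ x in ⋃ k ∈ I, E k, M x ^ q := by
        rw [← Finset.mul_sum, lintegral_biUnion_finset hpd fun k _ => hEm k]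
    _ ≤ _ := mul_le_mul' le_rfl (setLIntegral_le_lintegral _ _)

/-- The bump condition implies the outer testing condition on every shifted grid. -/
lemma outerTesting_of_bump {α β p q : ℝ} (hn : 0 < n) (hαn : α < n) (hp : 1 < p) (hq : 1 < q)
    (hβ : β = n * (1 / p - 1 / q)) {Φ : ℝ → ℝ} (hΦ : IsYoung Φ) {u σ : Rn n → ℝ}
    (hσm : Measurable σ) (hσ0 : ∀ x, 0 ≤ σ x)
    (hA : bumpA α p q Φ u σ < ∞) {t : Fin n → Bool} {S : Finset (Set (Rn n))}
    (hS : ∀ P ∈ S, P ∈ gridSets t) (hσt : ∀ P ∈ S, weightMeasure σ P ≠ ∞) :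
    OuterTesting S (gridCoeff n α) (weightMeasure σ) (weightMeasure u) p q
      (4 * geomConst (n - α) * (bumpA α p q Φ u σ * orliczMaxNorm n β (assocFn Φ) p q)) := by
  intro Q hQ
  have hq0 : 0 < q := by linarith
  have hp0 : 0 < p := by linarith
  have hn' : (n : ℝ) ≠ 0 := by positivity
  by_cases hσQ : weightMeasure σ Q = 0
  · simp [hσQ]
  obtain ⟨x₀, hx₀⟩ := nonempty_of_measure_ne_zero hσQ
  have hQm := measurableSet_of_mem_gridSets (hS Q hQ)
  have : ∀ P, ∃ k : ℤ, P ∈ S.filter (Q ⊆ ·) → P = (gridCube t k (gridIndex t k x₀)).set := by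
    intro P
    by_cases hP : P ∈ S.filter (Q ⊆ ·)
    · obtain ⟨hPS, hQP⟩ := Finset.mem_filter.1 hP
      obtain ⟨k, hk⟩ := eq_gridCube (hS P hPS) (hQP hx₀)
      exact ⟨k, fun _ => hk⟩
    · exact ⟨0, fun h => absurd h hP⟩
  choose κ hκ using this
  set A := bumpA α p q Φ u σ
  set b : Rn n → ℝ := Q.indicator fun x => σ x ^ (1 / p) with hb
  have hbm : Measurable b := (hσm.pow_const _).indicator hQm
  set G : ℤ → Cube n := fun k => gridCube t k (gridIndex t k x₀) with hG
  set c : ℤ → ℝ≥0∞ := fun k =>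
    ENNReal.ofReal ((G k).vol ^ (β / n)) * luxNorm (assocFn Φ) (G k) b with hc
  set M := orliczMax β (assocFn Φ) b
  have hM : ∀ k, ∀ x ∈ (G k).set, c k ≤ M x := fun k x hx =>
    le_iSup₂ (f := fun (Q : Cube n) (_ : x ∈ Q.set) =>
      ENNReal.ofReal (Q.vol ^ (β / n)) * luxNorm (assocFn Φ) Q b) (G k) hx
  have hbp : Lp0 b p = weightMeasure σ Q ^ (1 / p) := by
    rw [Lp0, weightMeasure, withDensity_apply _ hQm, ← lintegral_indicator hQm]
    congr 1
    refine lintegral_congr fun x => ?_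
    by_cases hx : x ∈ Q
    · rw [hb, indicator_of_mem hx, indicator_of_mem hx,
        abs_of_nonneg (Real.rpow_nonneg (hσ0 x) _),
        ENNReal.ofReal_rpow_of_nonneg (Real.rpow_nonneg (hσ0 x) _) hp0.le,
        ← Real.rpow_mul (hσ0 x), one_div_mul_cancel hp0.ne', Real.rpow_one]
    · simp [hb, indicator_of_notMem hx, hp0]
  have hMN : (∫⁻ x, M x ^ q) ^ (1 / q)
      ≤ orliczMaxNorm n β (assocFn Φ) p q * weightMeasure σ Q ^ (1 / p) := by
    have h1 : LpE M q / Lp0 b p ≤ orliczMaxNorm n β (assocFn Φ) p q :=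
      le_iSup₂ (f := fun (f : Rn n → ℝ) (_ : Measurable f) =>
        LpE (orliczMax β (assocFn Φ) f) q / Lp0 f p) b hbm
    rw [hbp, ENNReal.div_le_iff] at h1
    · exact h1
    · rw [Ne, ENNReal.rpow_eq_zero_iff_of_pos (by positivity)]
      exact hσQ
    · exact ENNReal.rpow_ne_top_of_nonneg (by positivity) (hσt Q hQ)
  have hterm : ∀ P ∈ S.filter (Q ⊆ ·), weightMeasure σ Q ^ q *
      (gridCoeff n α P ^ q * weightMeasure u P)
        ≤ (2 * A) ^ q * (volume (G (κ P)).set * c (κ P) ^ q) := by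
    intro P hP
    have hPe := hκ P hP
    have h1 := bump_cube_le hn hp hq0 hβ hΦ hσm hσ0 hA (G (κ P)) hQm
      ((Finset.mem_filter.1 hP).2.trans hPe.le)
    have h2 := ENNReal.rpow_le_rpow h1 hq0.le
    have hV := (G (κ P)).vol_pos
    have e1 : ∀ y : ℝ≥0∞, (y ^ (1 / q)) ^ q = y := fun y => by
      rw [← ENNReal.rpow_mul, one_div_mul_cancel hq0.ne', ENNReal.rpow_one]
    rw [ENNReal.mul_rpow_of_nonneg _ _ hq0.le, ENNReal.mul_rpow_of_nonneg _ _ hq0.le,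
      ENNReal.mul_rpow_of_nonneg (2 * A) _ hq0.le, ENNReal.mul_rpow_of_nonneg _ (_ * _) hq0.le,
      e1, ← ENNReal.ofReal_rpow_of_pos hV, ← ENNReal.ofReal_rpow_of_pos hV, e1,
      ← Cube.volume_set, ← hPe] at h2
    rw [← hPe]
    refine le_trans (le_of_eq ?_) h2
    rw [gridCoeff]
    ring
  have hmain : weightMeasure σ Q ^ q *
      ∫⁻ x, chainSum S (gridCoeff n α) Q x ^ q ∂weightMeasure u
        ≤ (geomConst (n - α) * (2 * A)) ^ q * (2 * ∫⁻ x, M x ^ q) := by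
    have hinj : Set.InjOn κ (S.filter (Q ⊆ ·)) := by
      intro P hP R hR hPR
      rw [hκ P hP, hκ R hR, hPR]
    calc _ ≤ weightMeasure σ Q ^ q * ∫⁻ x, geomConst (n - α) ^ q *
          ∑ P ∈ S with Q ⊆ P, P.indicator (fun _ => gridCoeff n α P ^ q) x ∂weightMeasure u := by
          gcongr with x
          exact chainSum_rpow_le hn hαn hq0 hκ x
      _ = geomConst (n - α) ^ q * ∑ P ∈ S with Q ⊆ P, weightMeasure σ Q ^ q *
          (gridCoeff n α P ^ q * weightMeasure u P) := by
          rw [lintegral_const_mul' _ _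
            (ENNReal.rpow_ne_top_of_nonneg hq0.le (geomConst_lt_top (by linarith)).ne),
            lintegral_finsetSum, ← Finset.mul_sum, mul_left_comm]
          · congr 2
            refine Finset.sum_congr rfl fun P hP => ?_
            rw [lintegral_indicator_const
              (measurableSet_of_mem_gridSets (hS P (Finset.mem_filter.1 hP).1))]
          · exact fun P hP => measurable_const.indicator
              (measurableSet_of_mem_gridSets (hS P (Finset.mem_filter.1 hP).1))
      _ ≤ geomConst (n - α) ^ q * ∑ P ∈ S with Q ⊆ P,
          (2 * A) ^ q * (volume (G (κ P)).set * c (κ P) ^ q) := by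
          exact mul_le_mul' le_rfl (Finset.sum_le_sum hterm)
      _ = (geomConst (n - α) * (2 * A)) ^ q *
          ∑ k ∈ (S.filter (Q ⊆ ·)).image κ, volume (G k).set * c k ^ q := by
          rw [Finset.sum_image hinj, ← Finset.mul_sum, ← mul_assoc,
            ENNReal.mul_rpow_of_nonneg (geomConst (n - α)) _ hq0.le]
      _ ≤ _ := mul_le_mul' le_rfl
          (sum_volume_mul_rpow_le hn hq0 _ c M fun k _ => hM k)
  have hroot := ENNReal.rpow_le_rpow hmain (show 0 ≤ 1 / q by positivity)
  have e2 : ∀ y : ℝ≥0∞, (y ^ q) ^ (1 / q) = y := fun y => by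
    rw [← ENNReal.rpow_mul, mul_one_div_cancel hq0.ne', ENNReal.rpow_one]
  rw [ENNReal.mul_rpow_of_nonneg _ _ (by positivity), e2,
    ENNReal.mul_rpow_of_nonneg _ _ (by positivity), e2,
    ENNReal.mul_rpow_of_nonneg _ _ (by positivity)] at hroot
  refine hroot.trans ?_
  have h2 : (2 : ℝ≥0∞) ^ (1 / q) ≤ 2 := by
    conv_rhs => rw [← ENNReal.rpow_one 2]
    exact ENNReal.rpow_le_rpow_of_exponent_le one_le_two ((div_le_one hq0).2 hq.le)
  calc geomConst (n - α) * (2 * A) * (2 ^ (1 / q) * (∫⁻ x, M x ^ q) ^ (1 / q))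
      ≤ geomConst (n - α) * (2 * A) * (2 *
        (orliczMaxNorm n β (assocFn Φ) p q * weightMeasure σ Q ^ (1 / p))) := by gcongr
    _ = 4 * geomConst (n - α) * (A * orliczMaxNorm n β (assocFn Φ) p q) *
        weightMeasure σ Q ^ (1 / p) := by ring

end GridTesting

section DyadicOperator

variable {X : Type*} [MeasurableSpace X]

/-- Strong type bound for finite positive dyadic operators under outer testing. -/
lemma finite_strong_le {p p' q q' : ℝ} (hpp : p.HolderConjugate p') (hqq : q'.HolderConjugate q)
    (hpq : p < q) {S : Finset (Set X)} (hS : IsNested S) (hm : ∀ Q ∈ S, MeasurableSet Q)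
    {lam : Set X → ℝ≥0∞} (hlam : ∀ Q ∈ S, lam Q ≠ ∞) {σ u : Measure X} {K₁ K₂ : ℝ≥0∞}
    (hK₁ : OuterTesting S lam σ u p q K₁) (hK₂ : OuterTesting S lam u σ q' p' K₂)
    (hσ : ∀ Q ∈ S, σ Q ≠ ∞) (hu : ∀ Q ∈ S, u Q ≠ ∞)
    {f : X → ℝ≥0∞} (hf : Measurable f) (hft : ∀ Q ∈ S, ∫⁻ x in Q, f x ∂σ ≠ ∞) :
    (∫⁻ x, (∑ Q ∈ S, Q.indicator (fun _ => lam Q * ∫⁻ y in Q, f y ∂σ) x) ^ q ∂u) ^ (1 / q)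
      ≤ (halfConst p q q' * K₁ + halfConst q' p' p * K₂) * (∫⁻ x, f x ^ p ∂σ) ^ (1 / p) := by
  have hq0 := hqq.symm.pos
  have hq1 := hqq.symm.lt
  have hq'0 := hqq.pos
  set c : Set X → ℝ≥0∞ := fun Q => lam Q * ∫⁻ y in Q, f y ∂σ with hc
  have hct : ∑ Q ∈ S, c Q ≠ ∞ :=
    ENNReal.sum_ne_top.2 fun Q hQ => ENNReal.mul_ne_top (hlam Q hQ) (hft Q hQ)
  set F : X → ℝ≥0∞ := fun x => ∑ Q ∈ S, Q.indicator (fun _ => c Q) x with hF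
  have hFm : Measurable F :=
    Finset.measurable_fun_sum _ fun Q hQ => measurable_const.indicator (hm Q hQ)
  have hFc : ∀ x, F x ≤ ∑ Q ∈ S, c Q := fun x =>
    Finset.sum_le_sum fun Q _ => Set.indicator_le_self' (fun _ _ => zero_le) x
  have hgm : Measurable fun x => F x ^ (q - 1) := hFm.pow_const _
  have hgt : ∀ Q ∈ S, ∫⁻ x in Q, F x ^ (q - 1) ∂u ≠ ∞ := fun Q hQ => by
    refine ne_top_of_le_ne_top ?_ (lintegral_mono fun x =>
      ENNReal.rpow_le_rpow (hFc x) (show 0 ≤ q - 1 by linarith))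
    rw [setLIntegral_const]
    exact ENNReal.mul_ne_top (ENNReal.rpow_ne_top_of_nonneg (by linarith) hct) (hu Q hQ)
  have hFq : ∀ x, F x ^ q = F x * F x ^ (q - 1) := fun x => by
    conv_rhs => enter [1]; rw [← ENNReal.rpow_one (F x)]
    rw [← ENNReal.rpow_add_of_nonneg _ _ zero_le_one (by linarith), add_sub_cancel]
  have hXe : ∫⁻ x, F x ^ q ∂u
      = ∑ Q ∈ S, lam Q * (∫⁻ x in Q, f x ∂σ) * ∫⁻ x in Q, F x ^ (q - 1) ∂u := by
    calc ∫⁻ x, F x ^ q ∂u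
        = ∫⁻ x, ∑ Q ∈ S, c Q * Q.indicator (fun x => F x ^ (q - 1)) x ∂u := by
          refine lintegral_congr fun x => ?_
          rw [hFq]
          conv_lhs => enter [1]; rw [hF]
          rw [Finset.sum_mul]
          refine Finset.sum_congr rfl fun Q _ => ?_
          by_cases hx : x ∈ Q <;> simp [hx]
      _ = _ := by
          rw [lintegral_finsetSum]
          · refine Finset.sum_congr rfl fun Q hQ => ?_
            rw [lintegral_const_mul _ (hgm.indicator (hm Q hQ)), lintegral_indicator (hm Q hQ)]
          · exact fun Q hQ => (hgm.indicator (hm Q hQ)).const_mul _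
  have hXt : ∫⁻ x, F x ^ q ∂u ≠ ∞ := by
    rw [hXe]
    exact ENNReal.sum_ne_top.2 fun Q hQ => ENNReal.mul_ne_top
      (ENNReal.mul_ne_top (hlam Q hQ) (hft Q hQ)) (hgt Q hQ)
  have hB := bilinear_sum_le hpp hqq hpq hS hm hK₁ hK₂ hσ hu hf hgm hft hgt
  rw [← hXe] at hB
  have e : ∀ x, (F x ^ (q - 1)) ^ q' = F x ^ q := fun x => by
    rw [← ENNReal.rpow_mul, hqq.symm.sub_one_mul_conj]
  simp only [e] at hB
  rcases eq_or_ne (∫⁻ x, F x ^ q ∂u) 0 with h0 | h0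
  · rw [h0, ENNReal.zero_rpow_of_pos (by positivity)]
    exact zero_le
  set Y := ∫⁻ x, F x ^ q ∂u
  have hsplit : Y = Y ^ (1 / q) * Y ^ (1 / q') := by
    rw [← ENNReal.rpow_add _ _ h0 hXt, one_div, one_div, hqq.symm.inv_add_inv_eq_one,
      ENNReal.rpow_one]
  have hY0 : Y ^ (1 / q') ≠ 0 := fun h =>
    h0 ((ENNReal.rpow_eq_zero_iff_of_pos (by positivity)).1 h)
  have hYt : Y ^ (1 / q') ≠ ∞ := ENNReal.rpow_ne_top_of_nonneg (by positivity) hXt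
  rw [← mul_assoc] at hB
  nth_rewrite 1 [hsplit] at hB
  exact (ENNReal.mul_le_mul_iff_left hY0 hYt).1 hB

/-- The positive dyadic operator of a family of sets. -/
def dyadicOp (D : Set (Set X)) (lam : Set X → ℝ≥0∞) (σ : Measure X) (f : X → ℝ≥0∞) (x : X) :
    ℝ≥0∞ :=
  ∑' Q : D, Q.1.indicator (fun _ => lam Q.1 * ∫⁻ y in Q.1, f y ∂σ) x

lemma measurable_dyadicOp {D : Set (Set X)} (hD : D.Countable) (hm : ∀ Q ∈ D, MeasurableSet Q)
    (lam : Set X → ℝ≥0∞) (σ : Measure X) (f : X → ℝ≥0∞) : Measurable (dyadicOp D lam σ f) := by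
  have := hD.to_subtype
  exact Measurable.tsum fun Q => measurable_const.indicator (hm Q.1 Q.2)

lemma dyadicOp_strong_le {D : Set (Set X)} (hD : D.Countable) (hm : ∀ Q ∈ D, MeasurableSet Q)
    {lam : Set X → ℝ≥0∞} {σ u : Measure X} {f : X → ℝ≥0∞} {q : ℝ} (hq : 0 < q) {B : ℝ≥0∞}
    (h : ∀ S : Finset (Set X), (∀ Q ∈ S, Q ∈ D) →
      (∫⁻ x, (∑ Q ∈ S, Q.indicator (fun _ => lam Q * ∫⁻ y in Q, f y ∂σ) x) ^ q ∂u) ^ (1 / q)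
        ≤ B) :
    ∫⁻ x, dyadicOp D lam σ f x ^ q ∂u ≤ B ^ q := by
  have := hD.to_subtype
  set T : Finset D → X → ℝ≥0∞ := fun S x =>
    ∑ Q ∈ S, Q.1.indicator (fun _ => lam Q.1 * ∫⁻ y in Q.1, f y ∂σ) x with hT
  have hTm : ∀ S, Measurable (T S) := fun S =>
    Finset.measurable_fun_sum _ fun Q _ => measurable_const.indicator (hm Q.1 Q.2)
  have e : ∀ x, dyadicOp D lam σ f x ^ q = ⨆ S, T S x ^ q := fun x => by
    rw [dyadicOp, ENNReal.tsum_eq_iSup_sum]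
    exact (ENNReal.orderIsoRpow q hq).map_iSup _
  simp only [e]
  rw [lintegral_iSup_directed fun S => ((hTm S).pow_const q).aemeasurable]
  · refine iSup_le fun S => ?_
    have h1 := h (S.map (Function.Embedding.subtype _)) (by simp +contextual)
    simp only [Finset.sum_map, Function.Embedding.subtype_apply] at h1
    have h2 := ENNReal.rpow_le_rpow h1 hq.le
    rwa [← ENNReal.rpow_mul, one_div_mul_cancel hq.ne', ENNReal.rpow_one] at h2
  · refine Monotone.directed_le fun S S' hSS x => ?_
    exact ENNReal.rpow_le_rpow (Finset.sum_le_sum_of_subset hSS) hq.le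

end DyadicOperator

section Riesz

variable {n : ℕ}

lemma weightMeasure_ne_top {w : Rn n → ℝ} (hw : IsWeight w) {t : Fin n → Bool} {P : Set (Rn n)}
    (hP : P ∈ gridSets t) : weightMeasure w P ≠ ∞ := by
  obtain ⟨⟨k, m⟩, rfl⟩ := hP
  set Q := gridCube t k m
  have hi : IntegrableOn w (Icc Q.corner fun i => Q.corner i + Q.side) volume :=
    hw.2.2.integrableOn_isCompact isCompact_Icc
  have hsub : Q.set ⊆ Icc Q.corner fun i => Q.corner i + Q.side := fun x hx =>
    ⟨fun i => (hx i).1, fun i => (hx i).2.le⟩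
  rw [weightMeasure, withDensity_apply _ Q.measurableSet]
  exact ((hi.mono_set hsub).lintegral_lt_top).ne

lemma lintegral_weightMeasure {w : Rn n → ℝ} (hw : Measurable w) {g : Rn n → ℝ≥0∞}
    (hg : Measurable g) :
    ∫⁻ x, g x ∂weightMeasure w = ∫⁻ x, g x * ENNReal.ofReal (w x) := by
  rw [weightMeasure, lintegral_withDensity_eq_lintegral_mul _ hw.ennreal_ofReal hg]
  exact lintegral_congr fun x => mul_comm _ _

lemma LpW_eq_lintegral_weightMeasure {w : Rn n → ℝ} (hw : Measurable w) {g : Rn n → ℝ≥0∞}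
    (hg : Measurable g) (p : ℝ) : LpW g p w = (∫⁻ x, g x ^ p ∂weightMeasure w) ^ (1 / p) := by
  rw [LpW, lintegral_weightMeasure hw (hg.pow_const p)]

/-- Pointwise domination of the Riesz potential by finitely many dyadic operators. -/
lemma riesz_mulW_le (hn : 0 < n) {α : ℝ} (hαn : α < n) {σ : Rn n → ℝ} (hσ : Measurable σ)
    {f : Rn n → ℝ≥0∞} (hf : Measurable f) (x : Rn n) :
    riesz α (mulW f σ) x ≤ 6 ^ (n - α) *
      ∑ t : Fin n → Bool, dyadicOp (gridSets t) (gridCoeff n α) (weightMeasure σ) f x := by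
  have hcount : ∀ t : Fin n → Bool, Countable (gridSets t) := fun t =>
    (countable_gridSets t).to_subtype
  have hfσ : Measurable (mulW f σ) := hf.mul hσ.ennreal_ofReal
  set k : (t : Fin n → Bool) → gridSets t → Rn n → ℝ≥0∞ := fun t Q y =>
    Q.1.indicator (fun _ => gridCoeff n α Q.1) x * Q.1.indicator (mulW f σ) y with hk
  have hkm : ∀ t Q, Measurable (k t Q) := fun t Q =>
    (hfσ.indicator (measurableSet_of_mem_gridSets Q.2)).const_mul _
  have hker : ∀ y, mulW f σ y * ENNReal.ofReal (eucNorm (x - y) ^ (α - n))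
      ≤ 6 ^ (n - α) * ∑ t : Fin n → Bool, ∑' Q : gridSets t, k t Q y := by
    intro y
    rcases eq_or_ne x y with rfl | hxy
    · have : eucNorm (x - x) = 0 := by simp [eucNorm]
      rw [this, Real.zero_rpow (by linarith : α - n < 0).ne]
      simp
    obtain ⟨t, P, hP, hxP, hyP, hle⟩ := exists_grid_kernel_le hn hαn hxy
    calc mulW f σ y * ENNReal.ofReal (eucNorm (x - y) ^ (α - n))
        ≤ mulW f σ y * (6 ^ (n - α) * gridCoeff n α P) := by gcongr
      _ = 6 ^ (n - α) * k t ⟨P, hP⟩ y := by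
          simp only [hk, indicator_of_mem hxP, indicator_of_mem hyP]
          ring
      _ ≤ _ := by
          gcongr
          exact (ENNReal.le_tsum (f := fun Q => k t Q y) ⟨P, hP⟩).trans
            (Finset.single_le_sum (f := fun t => ∑' Q : gridSets t, k t Q y)
              (fun _ _ => zero_le) (Finset.mem_univ t))
  calc riesz α (mulW f σ) x
      ≤ ∫⁻ y, 6 ^ (n - α) * ∑ t : Fin n → Bool, ∑' Q : gridSets t, k t Q y :=
        lintegral_mono hker
    _ = 6 ^ (n - α) * ∑ t : Fin n → Bool, ∑' Q : gridSets t, ∫⁻ y, k t Q y := by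
        rw [lintegral_const_mul, lintegral_finsetSum]
        · congr 1
          exact Finset.sum_congr rfl fun t _ =>
            lintegral_tsum fun Q => (hkm t Q).aemeasurable
        · exact fun t _ => Measurable.tsum (hkm t)
        · exact Finset.measurable_fun_sum _ fun t _ => Measurable.tsum (hkm t)
    _ = _ := by
        congr 1
        refine Finset.sum_congr rfl fun t _ => tsum_congr fun Q => ?_
        have hQm := measurableSet_of_mem_gridSets Q.2
        rw [lintegral_const_mul _ (hfσ.indicator hQm), lintegral_indicator hQm, weightMeasure,
          setLIntegral_withDensity_eq_setLIntegral_mul _ hσ.ennreal_ofReal hf hQm]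
        have : ∫⁻ y in Q.1, mulW f σ y
            = ∫⁻ y in Q.1, ((fun x => ENNReal.ofReal (σ x)) * f) y :=
          lintegral_congr fun y => mul_comm _ _
        rw [this]
        by_cases hx : x ∈ Q.1 <;> simp [hx]

/-- The constant in the two-weight bound for the Riesz potential. -/
def rieszConst (n : ℕ) (α p q : ℝ) : ℝ≥0∞ :=
  6 ^ (n - α) * Fintype.card (Fin n → Bool) *
    ((halfConst p q (conjExp q) + halfConst (conjExp q) (conjExp p) p) *
      (4 * geomConst (n - α))) + 1

lemma riesz_strong_le (hn : 0 < n) {α p q : ℝ} (hαn : α < n) (hp : 1 < p) (hpq : p < q)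
    {Φ Ψ : ℝ → ℝ} {u σ : Rn n → ℝ} (hΦ : IsYoung Φ) (hΨ : IsYoung Ψ) (hu : IsWeight u)
    (hσ : IsWeight σ) (hA : bumpA α p q Φ u σ < ∞)
    (hB : bumpA α (conjExp q) (conjExp p) Ψ σ u < ∞)
    {f : Rn n → ℝ≥0∞} (hf : Measurable f) (hfp : LpW f p σ ≠ ∞) :
    LpW (riesz α (mulW f σ)) q u ≤ rieszConst n α p q *
      (bumpA α p q Φ u σ * orliczMaxNorm n (n * (1 / p - 1 / q)) (assocFn Φ) p q +
        bumpA α (conjExp q) (conjExp p) Ψ σ u *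
          orliczMaxNorm n (n * (1 / p - 1 / q)) (assocFn Ψ) (conjExp q) (conjExp p)) *
      LpW f p σ := by
  have hpp : p.HolderConjugate (conjExp p) := Real.HolderConjugate.conjExponent hp
  have hqq : (conjExp q).HolderConjugate q :=
    (Real.HolderConjugate.conjExponent (hp.trans hpq)).symm
  have hq0 := hqq.symm.pos
  set p' := conjExp p
  set q' := conjExp q
  have hβ : (n : ℝ) * (1 / p - 1 / q) = n * (1 / q' - 1 / p') := by
    have h1 := hqq.inv_add_inv_eq_one
    have h2 := hpp.inv_add_inv_eq_one
    simp only [one_div]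
    congr 1
    linarith
  set A₁ := bumpA α p q Φ u σ * orliczMaxNorm n (n * (1 / p - 1 / q)) (assocFn Φ) p q
  set A₂ := bumpA α q' p' Ψ σ u * orliczMaxNorm n (n * (1 / p - 1 / q)) (assocFn Ψ) q' p'
  set μ := weightMeasure σ
  set ν := weightMeasure u
  rw [LpW_eq_lintegral_weightMeasure hσ.1 hf] at hfp ⊢
  set N := (∫⁻ x, f x ^ p ∂μ) ^ (1 / p)
  set H := (halfConst p q q' + halfConst q' p' p) * (4 * geomConst (n - α))
  have hNp : ∫⁻ x, f x ^ p ∂μ ≠ ∞ := fun h =>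
    hfp (by rw [show N = (∫⁻ x, f x ^ p ∂μ) ^ (1 / p) from rfl, h,
      ENNReal.top_rpow_of_pos (one_div_pos.2 hpp.pos)])
  have hgrid : ∀ t : Fin n → Bool,
      ∫⁻ x, dyadicOp (gridSets t) (gridCoeff n α) μ f x ^ q ∂ν ≤ (H * (A₁ + A₂) * N) ^ q := by
    intro t
    refine dyadicOp_strong_le (countable_gridSets t)
      (fun _ => measurableSet_of_mem_gridSets) hq0 fun S hS => ?_
    have hμS : ∀ Q ∈ S, μ Q ≠ ∞ := fun Q hQ => weightMeasure_ne_top hσ (hS Q hQ)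
    have hνS : ∀ Q ∈ S, ν Q ≠ ∞ := fun Q hQ => weightMeasure_ne_top hu (hS Q hQ)
    have hT₁ := outerTesting_of_bump hn hαn hp hqq.symm.lt rfl hΦ hσ.1 hσ.2.1 hA hS hμS
    have hT₂ := outerTesting_of_bump hn hαn hqq.lt hpp.symm.lt hβ hΨ hu.1 hu.2.1 hB hS hνS
    have hlam : ∀ Q ∈ S, gridCoeff n α Q ≠ ∞ := fun Q hQ => by
      obtain ⟨⟨k, m⟩, rfl⟩ := hS Q hQ
      rw [gridCoeff, Cube.volume_set, ENNReal.ofReal_rpow_of_pos (Cube.vol_pos _)]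
      exact ENNReal.ofReal_ne_top
    have hft : ∀ Q ∈ S, ∫⁻ x in Q, f x ∂μ ≠ ∞ := fun Q hQ => by
      have h1 : ∫⁻ x in Q, f x ∂μ ≤ ∫⁻ x in Q, (1 + f x ^ p) ∂μ := lintegral_mono fun x => by
        rcases le_total (f x) 1 with h | h
        · exact h.trans le_self_add
        · refine le_trans ?_ le_add_self
          exact ENNReal.le_rpow_self_of_one_le h hp.le
      refine ne_top_of_le_ne_top ?_ h1
      rw [lintegral_add_left measurable_const, setLIntegral_one]
      exact ENNReal.add_ne_top.2
        ⟨hμS Q hQ, ne_top_of_le_ne_top hNp (setLIntegral_le_lintegral _ _)⟩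
    refine (finite_strong_le hpp hqq hpq (fun P hP Q hQ => gridSets_nested (hS P hP) (hS Q hQ))
      (fun Q hQ => measurableSet_of_mem_gridSets (hS Q hQ)) hlam hT₁ hT₂ hμS hνS hf hft).trans ?_
    refine mul_le_mul' ?_ le_rfl
    calc halfConst p q q' * (4 * geomConst (n - α) * A₁) +
          halfConst q' p' p * (4 * geomConst (n - α) * A₂)
        ≤ (halfConst p q q' + halfConst q' p' p) * (4 * geomConst (n - α) * A₁) +
          (halfConst p q q' + halfConst q' p' p) * (4 * geomConst (n - α) * A₂) := by
          gcongr
          · exact le_self_add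
          · exact le_add_self
      _ = H * (A₁ + A₂) := by ring
  set c : ℝ≥0∞ := (Fintype.card (Fin n → Bool) : ℝ≥0∞) with hc
  have hopm : ∀ t : Fin n → Bool, Measurable (dyadicOp (gridSets t) (gridCoeff n α) μ f) :=
    fun t => measurable_dyadicOp (countable_gridSets t) (fun _ => measurableSet_of_mem_gridSets)
      _ _ _
  set G : Rn n → ℝ≥0∞ := fun x => 6 ^ (n - α) *
    ∑ t : Fin n → Bool, dyadicOp (gridSets t) (gridCoeff n α) μ f x with hG
  have hGm : Measurable G := (Finset.measurable_fun_sum _ fun t _ => hopm t).const_mul _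
  have hsum : ∫⁻ x, G x ^ q ∂ν ≤ (6 ^ (n - α) * c * (H * (A₁ + A₂) * N)) ^ q := by
    calc ∫⁻ x, G x ^ q ∂ν
        ≤ ∫⁻ x, ((6 ^ (n - α)) ^ q * c ^ (q - 1)) *
            ∑ t : Fin n → Bool, dyadicOp (gridSets t) (gridCoeff n α) μ f x ^ q ∂ν := by
          refine lintegral_mono fun x => ?_
          simp only [hG]
          rw [ENNReal.mul_rpow_of_nonneg _ _ hq0.le, mul_assoc]
          gcongr
          exact ENNReal.rpow_sum_le_const_mul_sum_rpow _ _ hqq.symm.lt.le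
      _ = ((6 ^ (n - α)) ^ q * c ^ (q - 1)) *
            ∑ t : Fin n → Bool, ∫⁻ x, dyadicOp (gridSets t) (gridCoeff n α) μ f x ^ q ∂ν := by
          rw [lintegral_const_mul, lintegral_finsetSum]
          · exact fun t _ => (hopm t).pow_const q
          · exact Finset.measurable_fun_sum _ fun t _ => (hopm t).pow_const q
      _ ≤ ((6 ^ (n - α)) ^ q * c ^ (q - 1)) *
            ∑ t : Fin n → Bool, (H * (A₁ + A₂) * N) ^ q := by
          gcongr with t
          exact hgrid t
      _ = _ := by
          rw [Finset.sum_const, nsmul_eq_mul, Finset.card_univ, ← hc,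
            ENNReal.mul_rpow_of_nonneg (_ * c) _ hq0.le, ENNReal.mul_rpow_of_nonneg _ c hq0.le]
          have : c ^ q = c ^ (q - 1) * c := by
            conv_rhs => enter [2]; rw [← ENNReal.rpow_one c]
            rw [← ENNReal.rpow_add_of_nonneg _ _ (by linarith) zero_le_one, sub_add_cancel]
          rw [this]
          ring
  calc LpW (riesz α (mulW f σ)) q u ≤ LpW G q u := by
        unfold LpW
        gcongr with x
        exact riesz_mulW_le hn hαn hσ.1 hf x
    _ ≤ 6 ^ (n - α) * c * (H * (A₁ + A₂) * N) := by
        rw [LpW_eq_lintegral_weightMeasure hu.1 hGm]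
        refine (ENNReal.rpow_le_rpow hsum (one_div_nonneg.2 hq0.le)).trans_eq ?_
        rw [← ENNReal.rpow_mul, mul_one_div_cancel hq0.ne', ENNReal.rpow_one]
    _ = 6 ^ (n - α) * c * H * (A₁ + A₂) * N := by ring
    _ ≤ _ := by
        gcongr
        exact le_self_add

lemma rieszConst_pos (n : ℕ) (α p q : ℝ) : 0 < rieszConst n α p q :=
  zero_lt_one.trans_le le_add_self

lemma rieszConst_lt_top {n : ℕ} {α p q : ℝ} (hαn : α < n) (hp : 1 < p) (hpq : p < q) :
    rieszConst n α p q < ∞ := by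
  have hpp : p.HolderConjugate (conjExp p) := Real.HolderConjugate.conjExponent hp
  have hqq : (conjExp q).HolderConjugate q :=
    (Real.HolderConjugate.conjExponent (hp.trans hpq)).symm
  have hq'p' : conjExp q < conjExp p := by
    have h1 := hqq.inv_add_inv_eq_one
    have h2 := hpp.inv_add_inv_eq_one
    have h3 : q⁻¹ < p⁻¹ := inv_strictAnti₀ hpp.pos hpq
    exact (inv_lt_inv₀ hpp.symm.pos hqq.pos).1 (by linarith)
  have h1 := halfConst_lt_top hp hpq hqq.lt
  have h2 := halfConst_lt_top hqq.lt hq'p' hp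
  have h3 := geomConst_lt_top (sub_pos.2 hαn)
  have h4 : (6 : ℝ≥0∞) ^ (n - α) < ∞ := ENNReal.rpow_lt_top_of_nonneg (by linarith) ofNat_ne_top
  unfold rieszConst
  finiteness

end Riesz

/-- separated bump, strong type, for the Riesz potential:
with `β = n(1/p - 1/q)`, if `Φ̄ ∈ B^β_p`, `Ψ̄ ∈ B^β_{q'}`, `[u,σ]_{A^α_{p,q,Φ}} < ∞`
and `[σ,u]_{A^α_{q',p',Ψ}} < ∞`, then `‖I_α(·σ)‖_{L^p(σ)→L^q(u)}` is bounded by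
`C ([u,σ]_{A^α_{p,q,Φ}} ‖M_{β,Φ̄}‖_{L^p→L^q} + [σ,u]_{A^α_{q',p',Ψ}} ‖M_{β,Ψ̄}‖_{L^{q'}→L^{p'}})`. -/
theorem stmt13 (n : ℕ) (hn : 0 < n) (α p q : ℝ) (hα : 0 < α) (hαn : α < n)
    (hp : 1 < p) (hpq : p < q) :
    ∃ C : ℝ≥0∞, 0 < C ∧ C < ∞ ∧
      ∀ (Φ Ψ : ℝ → ℝ) (u σ : Rn n → ℝ), IsYoung Φ → IsYoung Ψ →
        BCond (assocFn Φ) p q → BCond (assocFn Ψ) (conjExp q) (conjExp p) →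
        IsWeight u → IsWeight σ →
        bumpA α p q Φ u σ < ∞ → bumpA α (conjExp q) (conjExp p) Ψ σ u < ∞ →
        opNormStrong (riesz α) p q σ u ≤
          C * (bumpA α p q Φ u σ *
              orliczMaxNorm n (n * (1 / p - 1 / q)) (assocFn Φ) p q +
            bumpA α (conjExp q) (conjExp p) Ψ σ u *
              orliczMaxNorm n (n * (1 / p - 1 / q)) (assocFn Ψ) (conjExp q) (conjExp p)) := by
  refine ⟨rieszConst n α p q, rieszConst_pos n α p q, rieszConst_lt_top hαn hp hpq, ?_⟩
  intro Φ Ψ u σ hΦ hΨ _ _ hu hσ hA hB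
  refine iSup₂_le fun f hf => ?_
  by_cases h : LpW f p σ = ∞
  · rw [h, ENNReal.div_top]
    exact zero_le
  · exact ENNReal.div_le_of_le_mul (riesz_strong_le hn hαn hp hpq hΦ hΨ hu hσ hA hB hf h)
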